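/- Square integrability in time of the decay norms: let φ be a rapidly decaying smooth solution of the Hartree equation with v(x) = χ(|x|)/|x|, where χ : [0,∞) → [0,∞) is smooth, compactly supported, and nonincreasing. Then ∫_1^∞ ‖φ(t,·)‖²_{L⁶(ℝ³)} dt < ∞ and ∫_1^∞ ‖φ(t,·)‖²_{L⁴(ℝ³)} dt < ∞. -/

import Mathlib

open MeasureTheory

noncomputable section

/-- Three-dimensional Euclidean space. -/
abbrev E3 : Type := EuclideanSpace ℝ (Fin 3)

/-- Spatial Laplacian of a complex-valued function on `ℝ³`. -/
def lapC (f : E3 → ℂ) (x : E3) : ℂ :=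
  ∑ j : Fin 3, fderiv ℝ (fun y => fderiv ℝ f y (EuclideanSpace.single j 1)) x
    (EuclideanSpace.single j 1)

/-- Spatial Laplacian of a real-valued function on `ℝ³`. -/
def lapR (f : E3 → ℝ) (x : E3) : ℝ :=
  ∑ j : Fin 3, fderiv ℝ (fun y => fderiv ℝ f y (EuclideanSpace.single j 1)) x
    (EuclideanSpace.single j 1)

/-- The Hartree self-interaction potential `W = v * |f|²` (convolution on `ℝ³`). -/
def hartreeW (v : E3 → ℝ) (f : E3 → ℂ) (x : E3) : ℝ :=
  MeasureTheory.convolution v (fun y => ‖f y‖ ^ 2) (ContinuousLinearMap.lsmul ℝ ℝ) volume x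

/-- A rapidly decaying smooth solution of the Hartree equation
`i ∂ₜ φ + Δφ − (v * |φ|²) φ = 0`:  `φ` is smooth on space-time, every spatial
Schwartz-type seminorm of every space-time derivative of `φ` is bounded on compact
time intervals, and the equation holds pointwise. -/
structure IsHartreeSolution (v : E3 → ℝ) (φ : ℝ → E3 → ℂ) : Prop where
  smooth : ContDiff ℝ (⊤ : ℕ∞) (fun p : ℝ × E3 => φ p.1 p.2)
  decay : ∀ (k n : ℕ) (T : ℝ), ∃ C : ℝ, ∀ (t : ℝ) (x : E3), |t| ≤ T →
    ‖x‖ ^ k * ‖iteratedFDeriv ℝ n (fun p : ℝ × E3 => φ p.1 p.2) (t, x)‖ ≤ C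
  eqn : ∀ (t : ℝ) (x : E3),
    Complex.I * deriv (fun s => φ s x) t + lapC (φ t) x
      - (hartreeW v (φ t) x : ℂ) * φ t x = 0

/-- Mass density `ρ = ½|φ|²`. -/
def rhoH (φ : ℝ → E3 → ℂ) (t : ℝ) (x : E3) : ℝ := (1 / 2 : ℝ) * ‖φ t x‖ ^ 2

/-- The pseudoconformally rescaled profile `ψ_t(x) = e^{i|x|²/(4t)} φ(t,x)`. -/
def psiH (φ : ℝ → E3 → ℂ) (t : ℝ) (x : E3) : ℂ :=
  Complex.exp (Complex.I * ((‖x‖ ^ 2 : ℝ) / (4 * t))) * φ t x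

/-- The pseudoconformal energy
`E_c(t) = t² ∫ ( |∇ψ_t|² + W ρ ) dx`. -/
def EcH (v : E3 → ℝ) (φ : ℝ → E3 → ℂ) (t : ℝ) : ℝ :=
  t ^ 2 * ∫ x : E3,
    ((∑ j : Fin 3, ‖fderiv ℝ (psiH φ t) x (EuclideanSpace.single j 1)‖ ^ 2)
      + hartreeW v (φ t) x * rhoH φ t x)

/-- The pseudoconformal remainder
`R_c(t) = t ∫∫ ( −4V(|x−y|) − 2|x−y| V′(|x−y|) ) ρ(t,x) ρ(t,y) dx dy`. -/
def RcH (V : ℝ → ℝ) (φ : ℝ → E3 → ℂ) (t : ℝ) : ℝ :=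
  t * ∫ x : E3, ∫ y : E3,
    (-4 * V ‖x - y‖ - 2 * ‖x - y‖ * deriv V ‖x - y‖) * rhoH φ t x * rhoH φ t y

/-- The remainder for the rescaled pseudoconformal energy:
`R_cc(t) = ∫ |∇ψ_t|² dx − 2 ∫∫ ( V(|x−y|) + |x−y| V′(|x−y|) ) ρ(t,x) ρ(t,y) dx dy`. -/
def RccH (V : ℝ → ℝ) (φ : ℝ → E3 → ℂ) (t : ℝ) : ℝ :=
  (∫ x : E3, ∑ j : Fin 3, ‖fderiv ℝ (psiH φ t) x (EuclideanSpace.single j 1)‖ ^ 2)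
    - 2 * ∫ x : E3, ∫ y : E3,
        (V ‖x - y‖ + ‖x - y‖ * deriv V ‖x - y‖) * rhoH φ t x * rhoH φ t y

/-- The hypotheses on the cut-off `χ` in the Coulomb-type potential `v(x) = χ(|x|)/|x|`:
`χ` is smooth, nonnegative, compactly supported and nonincreasing on `[0,∞)`. -/
structure IsCutoff (χ : ℝ → ℝ) : Prop where
  smooth : ContDiff ℝ (⊤ : ℕ∞) χ
  nonneg : ∀ r, 0 ≤ χ r
  compact_supp : HasCompactSupport χ
  mono : AntitoneOn χ (Set.Ici 0)

section DecayOfHartreeFlows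

open scoped ContDiff ComplexConjugate

/-- A smooth function on space-time all of whose derivatives decay rapidly in space, locally
uniformly in time. -/
structure RapidDecay (F : ℝ × E3 → ℂ) : Prop where
  smooth : ContDiff ℝ ∞ F
  decay : ∀ (k n : ℕ) (T : ℝ), ∃ C : ℝ, ∀ (t : ℝ) (x : E3), |t| ≤ T →
    ‖x‖ ^ k * ‖iteratedFDeriv ℝ n F (t, x)‖ ≤ C

/-- Smooth functions on space-time with spatially polynomial growth of all derivatives. -/
structure PolyGrowth (g : ℝ × E3 → ℂ) : Prop where
  smooth : ContDiff ℝ ∞ g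
  growth : ∀ (n : ℕ) (T : ℝ), ∃ (k : ℕ) (C : ℝ), ∀ (t : ℝ) (x : E3), |t| ≤ T →
    ‖iteratedFDeriv ℝ n g (t, x)‖ ≤ C * (1 + ‖x‖) ^ k

/-- Directional derivative on space-time. -/
def dirD (u : ℝ × E3) (F : ℝ × E3 → ℂ) (p : ℝ × E3) : ℂ := fderiv ℝ F p u

/-- The time direction. -/
def timeDir : ℝ × E3 := (1, 0)

/-- The `j`-th spatial direction. -/
def spaceDir (j : Fin 3) : ℝ × E3 := (0, EuclideanSpace.single j 1)

lemma RapidDecay.polyGrowth {F : ℝ × E3 → ℂ} (hF : RapidDecay F) : PolyGrowth F :=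
  ⟨hF.smooth, fun n T => by
    obtain ⟨C, hC⟩ := hF.decay 0 n T
    exact ⟨0, C, fun t x ht => by simpa using hC t x ht⟩⟩

lemma Function.HasTemperateGrowth.polyGrowth {g : ℝ × E3 → ℂ}
    (hg : Function.HasTemperateGrowth g) : PolyGrowth g := by
  refine ⟨hg.1, fun n T => ?_⟩
  obtain ⟨k, C, hC⟩ := hg.2 n
  refine ⟨k, |C| * (1 + |T|) ^ k, fun t x ht => (hC (t, x)).trans ?_⟩
  rw [mul_assoc, ← mul_pow]
  have h1 : ‖(t, x)‖ ≤ |t| + ‖x‖ := by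
    rw [Prod.norm_def]
    exact max_le (by simp) (by simp)
  gcongr
  · exact le_abs_self C
  · nlinarith [norm_nonneg x, abs_nonneg T, le_abs_self T, mul_nonneg (norm_nonneg x) (abs_nonneg T)]

lemma RapidDecay.decay_one_add {F : ℝ × E3 → ℂ} (hF : RapidDecay F) (k n : ℕ) (T : ℝ) :
    ∃ C : ℝ, 0 ≤ C ∧ ∀ (t : ℝ) (x : E3), |t| ≤ T →
      (1 + ‖x‖) ^ k * ‖iteratedFDeriv ℝ n F (t, x)‖ ≤ C := by
  obtain ⟨C0, h0⟩ := hF.decay 0 n T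
  obtain ⟨C1, h1⟩ := hF.decay k n T
  refine ⟨2 ^ k * (|C0| + |C1|), by positivity, fun t x ht => ?_⟩
  have a0 := h0 t x ht
  have a1 := h1 t x ht
  have hb : (1 + ‖x‖) ^ k ≤ 2 ^ k * (1 + ‖x‖ ^ k) := by
    have := add_pow_le (zero_le_one : (0:ℝ) ≤ 1) (norm_nonneg x) k
    refine this.trans ?_
    rw [one_pow]
    gcongr
    · norm_num
    · omega
  calc (1 + ‖x‖) ^ k * ‖iteratedFDeriv ℝ n F (t, x)‖
      ≤ 2 ^ k * (1 + ‖x‖ ^ k) * ‖iteratedFDeriv ℝ n F (t, x)‖ := by gcongr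
    _ = 2 ^ k * (‖x‖ ^ 0 * ‖iteratedFDeriv ℝ n F (t, x)‖
          + ‖x‖ ^ k * ‖iteratedFDeriv ℝ n F (t, x)‖) := by ring
    _ ≤ 2 ^ k * (|C0| + |C1|) := by
        gcongr
        · exact a0.trans (le_abs_self _)
        · exact a1.trans (le_abs_self _)

lemma RapidDecay.polyGrowth_mul {g F : ℝ × E3 → ℂ} (hg : PolyGrowth g) (hF : RapidDecay F) :
    RapidDecay (fun p => g p * F p) := by
  refine ⟨hg.smooth.mul hF.smooth, fun k n T => ?_⟩
  choose kg Cg hCg using fun i => hg.growth i T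
  choose CF hCF0 hCF using fun l i => hF.decay_one_add l i T
  refine ⟨∑ i ∈ Finset.range (n + 1), (n.choose i : ℝ) * |Cg i| * CF (kg i + k) (n - i),
    fun t x ht => ?_⟩
  have h := norm_iteratedFDeriv_mul_le hg.smooth hF.smooth (t, x) (n := n)
    (by exact_mod_cast le_top)
  refine (mul_le_mul_of_nonneg_left h (by positivity)).trans ?_
  rw [Finset.mul_sum]
  refine Finset.sum_le_sum fun i _ => ?_
  have h1 : ‖iteratedFDeriv ℝ i g (t, x)‖ ≤ |Cg i| * (1 + ‖x‖) ^ kg i :=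
    (hCg i t x ht).trans (by gcongr; exact le_abs_self _)
  have h2 := hCF (kg i + k) (n - i) t x ht
  have h3 : ‖x‖ ^ k ≤ (1 + ‖x‖) ^ k := by gcongr; linarith
  calc _ ≤ (1 + ‖x‖) ^ k * ((n.choose i : ℝ) * (|Cg i| * (1 + ‖x‖) ^ kg i)
          * ‖iteratedFDeriv ℝ (n - i) F (t, x)‖) := by gcongr
    _ = (n.choose i : ℝ) * |Cg i| *
          ((1 + ‖x‖) ^ (kg i + k) * ‖iteratedFDeriv ℝ (n - i) F (t, x)‖) := by ring
    _ ≤ _ := by gcongr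

lemma RapidDecay.mul {F G : ℝ × E3 → ℂ} (hF : RapidDecay F) (hG : RapidDecay G) :
    RapidDecay (fun p => F p * G p) :=
  RapidDecay.polyGrowth_mul hF.polyGrowth hG

lemma RapidDecay.temperate_mul {g F : ℝ × E3 → ℂ} (hg : Function.HasTemperateGrowth g)
    (hF : RapidDecay F) : RapidDecay (fun p => g p * F p) :=
  RapidDecay.polyGrowth_mul hg.polyGrowth hF

lemma RapidDecay.const_mul {F : ℝ × E3 → ℂ} (c : ℂ) (hF : RapidDecay F) :
    RapidDecay (fun p => c * F p) :=
  RapidDecay.temperate_mul (g := fun _ => c) (by fun_prop) hF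

lemma RapidDecay.coord_mul {F : ℝ × E3 → ℂ} (k : Fin 3) (hF : RapidDecay F) :
    RapidDecay (fun p => (p.2 k : ℂ) * F p) :=
  RapidDecay.temperate_mul (g := fun p : ℝ × E3 => (p.2 k : ℂ))
    ((Complex.ofRealCLM ∘L EuclideanSpace.proj k ∘L
      ContinuousLinearMap.snd ℝ ℝ E3).hasTemperateGrowth) hF

lemma RapidDecay.time_mul {F : ℝ × E3 → ℂ} (hF : RapidDecay F) :
    RapidDecay (fun p => (p.1 : ℂ) * F p) :=
  RapidDecay.temperate_mul (g := fun p : ℝ × E3 => (p.1 : ℂ))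
    ((Complex.ofRealCLM ∘L ContinuousLinearMap.fst ℝ ℝ E3).hasTemperateGrowth) hF

lemma RapidDecay.add {F G : ℝ × E3 → ℂ} (hF : RapidDecay F) (hG : RapidDecay G) :
    RapidDecay (fun p => F p + G p) := by
  refine ⟨hF.smooth.add hG.smooth, fun k n T => ?_⟩
  obtain ⟨C, hC⟩ := hF.decay k n T
  obtain ⟨C', hC'⟩ := hG.decay k n T
  refine ⟨C + C', fun t x ht => ?_⟩
  have : iteratedFDeriv ℝ n (fun p => F p + G p) (t, x)
      = iteratedFDeriv ℝ n F (t, x) + iteratedFDeriv ℝ n G (t, x) :=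
    iteratedFDeriv_add_apply (hF.smooth.contDiffAt.of_le (by exact_mod_cast le_top))
      (hG.smooth.contDiffAt.of_le (by exact_mod_cast le_top))
  rw [this]
  calc _ ≤ ‖x‖ ^ k * (‖iteratedFDeriv ℝ n F (t, x)‖ + ‖iteratedFDeriv ℝ n G (t, x)‖) := by
        gcongr; exact norm_add_le _ _
    _ ≤ _ := by rw [mul_add]; exact add_le_add (hC t x ht) (hC' t x ht)

lemma RapidDecay.sum {F : Fin 3 → ℝ × E3 → ℂ} (hF : ∀ j, RapidDecay (F j)) :
    RapidDecay (fun p => ∑ j, F j p) := by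
  simp only [Fin.sum_univ_three]
  exact ((hF 0).add (hF 1)).add (hF 2)

lemma RapidDecay.star {F : ℝ × E3 → ℂ} (hF : RapidDecay F) :
    RapidDecay (fun p => (starRingEnd ℂ) (F p)) := by
  refine ⟨Complex.conjCLE.contDiff.comp hF.smooth, fun k n T => ?_⟩
  obtain ⟨C, hC⟩ := hF.decay k n T
  refine ⟨C, fun t x ht => ?_⟩
  have := Complex.conjLIE.norm_iteratedFDeriv_comp_left F (t, x) n
  refine le_trans (le_of_eq ?_) (hC t x ht)
  rw [← this]; rfl

lemma RapidDecay.directional {F : ℝ × E3 → ℂ} (hF : RapidDecay F) (u : ℝ × E3) :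
    RapidDecay (dirD u F) := by
  have hs : ContDiff ℝ ∞ (fderiv ℝ F) := hF.smooth.fderiv_right (by exact_mod_cast le_top)
  refine ⟨hs.clm_apply contDiff_const, fun k n T => ?_⟩
  obtain ⟨C, hC⟩ := hF.decay k (n + 1) T
  refine ⟨‖u‖ * C, fun t x ht => ?_⟩
  have h := norm_iteratedFDeriv_clm_apply_const (c := u) (n := n)
    (hs.contDiffAt (x := (t, x))) (by exact_mod_cast le_top)
  rw [norm_iteratedFDeriv_fderiv] at h
  have h' := hC t x ht
  calc _ ≤ ‖x‖ ^ k * (‖u‖ * ‖iteratedFDeriv ℝ (n + 1) F (t, x)‖) := by gcongr; exact h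
    _ = ‖u‖ * (‖x‖ ^ k * ‖iteratedFDeriv ℝ (n + 1) F (t, x)‖) := by ring
    _ ≤ _ := by gcongr

lemma RapidDecay.differentiable {F : ℝ × E3 → ℂ} (hF : RapidDecay F) : Differentiable ℝ F :=
  hF.smooth.differentiable (by simp)

lemma RapidDecay.continuous_slice {F : ℝ × E3 → ℂ} (hF : RapidDecay F) (t : ℝ) :
    Continuous (fun x => F (t, x)) :=
  hF.smooth.continuous.comp (by fun_prop)

/-- Pointwise domination by an integrable power of the Japanese bracket. -/
lemma RapidDecay.bound {F : ℝ × E3 → ℂ} (hF : RapidDecay F) (T : ℝ) :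
    ∃ C : ℝ, 0 ≤ C ∧ ∀ (t : ℝ) (x : E3), |t| ≤ T → ‖F (t, x)‖ ≤ C * (1 + ‖x‖) ^ (-4 : ℝ) := by
  obtain ⟨C, h0, hC⟩ := hF.decay_one_add 4 0 T
  refine ⟨C, h0, fun t x ht => ?_⟩
  have h := hC t x ht
  rw [norm_iteratedFDeriv_zero] at h
  rw [Real.rpow_neg (by positivity), ← div_eq_mul_inv, le_div_iff₀ (by positivity)]
  have : (1 + ‖x‖) ^ (4:ℝ) = (1 + ‖x‖) ^ 4 := by exact_mod_cast Real.rpow_natCast _ 4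
  rw [this]; linarith

lemma integrable_bracket : Integrable (fun x : E3 => (1 + ‖x‖) ^ (-4 : ℝ)) :=
  integrable_one_add_norm (by simp; norm_num)

lemma RapidDecay.integrable {F : ℝ × E3 → ℂ} (hF : RapidDecay F) (t : ℝ) :
    Integrable (fun x => F (t, x)) := by
  obtain ⟨C, _, hC⟩ := hF.bound |t|
  exact (integrable_bracket.const_mul C).mono' (hF.continuous_slice t).aestronglyMeasurable
    (ae_of_all _ fun x => hC t x le_rfl)

lemma hasDerivAt_time {F : ℝ × E3 → ℂ} (hF : Differentiable ℝ F) (t : ℝ) (x : E3) :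
    HasDerivAt (fun s => F (s, x)) (dirD timeDir F (t, x)) t := by
  have h1 : HasFDerivAt F (fderiv ℝ F (t, x)) (t, x) := (hF (t, x)).hasFDerivAt
  have h2 : HasDerivAt (fun s : ℝ => (s, x)) ((1 : ℝ), (0 : E3)) t :=
    (hasDerivAt_id t).prodMk (hasDerivAt_const t x)
  exact h1.comp_hasDerivAt t h2

lemma hasFDerivAt_slice {F : ℝ × E3 → ℂ} (hF : Differentiable ℝ F) (t : ℝ) (x : E3) :
    HasFDerivAt (fun y => F (t, y))
      ((fderiv ℝ F (t, x)).comp (ContinuousLinearMap.inr ℝ ℝ E3)) x := by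
  have h1 : HasFDerivAt F (fderiv ℝ F (t, x)) (t, x) := (hF (t, x)).hasFDerivAt
  exact h1.comp x (hasFDerivAt_prodMk_right t x)

lemma fderiv_slice {F : ℝ × E3 → ℂ} (hF : Differentiable ℝ F) (t : ℝ) (x : E3) (j : Fin 3) :
    fderiv ℝ (fun y => F (t, y)) x (EuclideanSpace.single j 1) = dirD (spaceDir j) F (t, x) := by
  rw [(hasFDerivAt_slice hF t x).fderiv]; rfl

lemma RapidDecay.hasDerivAt_integral {F : ℝ × E3 → ℂ} (hF : RapidDecay F) (t : ℝ) :
    HasDerivAt (fun s => ∫ x, F (s, x)) (∫ x, dirD timeDir F (t, x)) t := by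
  obtain ⟨C, _, hC⟩ := (hF.directional timeDir).bound (|t| + 1)
  refine (hasDerivAt_integral_of_dominated_loc_of_deriv_le (F := fun s x => F (s, x))
    (F' := fun s x => dirD timeDir F (s, x))
    (bound := fun x => C * (1 + ‖x‖) ^ (-4 : ℝ)) (Metric.ball_mem_nhds t one_pos)
    (Filter.Eventually.of_forall fun s => (hF.integrable s).1) (hF.integrable t)
    ((hF.directional timeDir).integrable t).1 (ae_of_all _ fun x s hs => hC s x ?_)
    (integrable_bracket.const_mul C)
    (ae_of_all _ fun x s _ => hasDerivAt_time hF.differentiable s x)).2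
  have : |s - t| < 1 := by simpa [Real.dist_eq] using hs
  have := abs_sub_abs_le_abs_sub s t
  linarith

lemma RapidDecay.integral_spaceDir {F : ℝ × E3 → ℂ} (hF : RapidDecay F) (t : ℝ) (j : Fin 3) :
    ∫ x, dirD (spaceDir j) F (t, x) = 0 := by
  have h := integral_mul_fderiv_eq_neg_fderiv_mul_of_integrable (𝕜 := ℂ) (μ := volume)
    (f := fun _ : E3 => (1:ℂ))
    (g := fun x => F (t, x)) (v := EuclideanSpace.single j 1) (by simp)
    (by simpa [fderiv_slice hF.differentiable] using (hF.directional (spaceDir j)).integrable t)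
    (by simpa using hF.integrable t) (fun x _ => by fun_prop)
    (fun x _ => (hasFDerivAt_slice hF.differentiable t x).differentiableAt)
  simpa [fderiv_slice hF.differentiable] using h

lemma dirD_add {F G : ℝ × E3 → ℂ} (hF : Differentiable ℝ F) (hG : Differentiable ℝ G)
    (u p : ℝ × E3) : dirD u (fun q => F q + G q) p = dirD u F p + dirD u G p := by
  simp [dirD, fderiv_fun_add (hF p) (hG p)]

lemma dirD_sum {F : Fin 3 → ℝ × E3 → ℂ} (hF : ∀ j, Differentiable ℝ (F j)) (u p : ℝ × E3) :
    dirD u (fun q => ∑ j, F j q) p = ∑ j, dirD u (F j) p := by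
  simp [dirD, fderiv_fun_sum (fun i _ => hF i p)]

lemma dirD_mul {F G : ℝ × E3 → ℂ} (hF : Differentiable ℝ F) (hG : Differentiable ℝ G)
    (u p : ℝ × E3) :
    dirD u (fun q => F q * G q) p = dirD u F p * G p + F p * dirD u G p := by
  simp [dirD, fderiv_fun_mul (hF p) (hG p)]; ring

lemma dirD_const_mul {F : ℝ × E3 → ℂ} (hF : Differentiable ℝ F) (c : ℂ) (u p : ℝ × E3) :
    dirD u (fun q => c * F q) p = c * dirD u F p := by
  simp [dirD, fderiv_const_mul (hF p) c]

lemma dirD_coord_mul {F : ℝ × E3 → ℂ} (hF : Differentiable ℝ F) (k : Fin 3) (u p : ℝ × E3) :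
    dirD u (fun q => (q.2 k : ℂ) * F q) p = (u.2 k : ℂ) * F p + (p.2 k : ℂ) * dirD u F p := by
  have h : HasFDerivAt (fun q : ℝ × E3 => (q.2 k : ℂ)) (Complex.ofRealCLM ∘L
      EuclideanSpace.proj k ∘L ContinuousLinearMap.snd ℝ ℝ E3) p :=
    (Complex.ofRealCLM ∘L EuclideanSpace.proj k ∘L
      ContinuousLinearMap.snd ℝ ℝ E3).hasFDerivAt
  simp only [dirD, (h.fun_mul (hF p).hasFDerivAt).fderiv]
  simp; ring

lemma dirD_time_mul {F : ℝ × E3 → ℂ} (hF : Differentiable ℝ F) (u p : ℝ × E3) :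
    dirD u (fun q => (q.1 : ℂ) * F q) p = (u.1 : ℂ) * F p + (p.1 : ℂ) * dirD u F p := by
  have h : HasFDerivAt (fun q : ℝ × E3 => (q.1 : ℂ)) (Complex.ofRealCLM ∘L
      ContinuousLinearMap.fst ℝ ℝ E3) p :=
    (Complex.ofRealCLM ∘L ContinuousLinearMap.fst ℝ ℝ E3).hasFDerivAt
  simp only [dirD, (h.fun_mul (hF p).hasFDerivAt).fderiv]
  simp; ring

lemma dirD_conj {F : ℝ × E3 → ℂ} (hF : Differentiable ℝ F) (u p : ℝ × E3) :
    dirD u (fun q => conj (F q)) p = conj (dirD u F p) := by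
  have h : HasFDerivAt (fun q => conj (F q))
      ((Complex.conjCLE : ℂ →L[ℝ] ℂ) ∘L fderiv ℝ F p) p :=
    (Complex.conjCLE : ℂ →L[ℝ] ℂ).hasFDerivAt.comp p (hF p).hasFDerivAt
  simp [dirD, h.fderiv]

lemma dirD_comm {F : ℝ × E3 → ℂ} (hF : ContDiff ℝ ∞ F) (u w p : ℝ × E3) :
    dirD u (dirD w F) p = dirD w (dirD u F) p := by
  have hd : Differentiable ℝ (fderiv ℝ F) :=
    (hF.fderiv_right (m := ∞) (by exact_mod_cast le_top)).differentiable (by simp)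
  have key : ∀ a b : ℝ × E3, dirD a (dirD b F) p = fderiv ℝ (fderiv ℝ F) p a b := fun a b => by
    have : HasFDerivAt (dirD b F) ((ContinuousLinearMap.apply ℝ ℂ b) ∘L
        fderiv ℝ (fderiv ℝ F) p) p :=
      (ContinuousLinearMap.apply ℝ ℂ b).hasFDerivAt.comp p (hd p).hasFDerivAt
    rw [dirD, this.fderiv]; rfl
  rw [key, key]
  exact (hF.contDiffAt.isSymmSndFDerivAt (by
    simp only [minSmoothness_of_isRCLikeNormedField]
    exact WithTop.coe_le_coe.2 le_top)) u w

/-- Spatial Laplacian of a function on space-time. -/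
def spaceLap (F : ℝ × E3 → ℂ) (p : ℝ × E3) : ℂ :=
  ∑ j, dirD (spaceDir j) (dirD (spaceDir j) F) p

/-- The Galilei generator `x_k + 2 i t ∂_k`. -/
def galilei (k : Fin 3) (F : ℝ × E3 → ℂ) (p : ℝ × E3) : ℂ :=
  (p.2 k : ℂ) * F p + (2 * Complex.I) * ((p.1 : ℂ) * dirD (spaceDir k) F p)

lemma RapidDecay.spaceLap {F : ℝ × E3 → ℂ} (hF : RapidDecay F) : RapidDecay (spaceLap F) :=
  RapidDecay.sum fun j => (hF.directional (spaceDir j)).directional (spaceDir j)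

lemma RapidDecay.galilei {F : ℝ × E3 → ℂ} (hF : RapidDecay F) (k : Fin 3) :
    RapidDecay (galilei k F) :=
  (hF.coord_mul k).add ((hF.directional _).time_mul.const_mul _)

lemma dirD_galilei {F : ℝ × E3 → ℂ} (hF : RapidDecay F) (k : Fin 3) (u p : ℝ × E3) :
    dirD u (galilei k F) p = (u.2 k : ℂ) * F p + 2 * Complex.I * u.1 * dirD (spaceDir k) F p
      + galilei k (dirD u F) p := by
  have h1 := hF.differentiable
  have h2 := (hF.directional (spaceDir k)).differentiable
  have h3 := (hF.directional (spaceDir k)).time_mul.differentiable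
  have := dirD_add (hF.coord_mul k).differentiable
    ((hF.directional (spaceDir k)).time_mul.const_mul (2 * Complex.I)).differentiable u p
  refine this.trans ?_
  rw [dirD_coord_mul h1, dirD_const_mul h3, dirD_time_mul h2, dirD_comm hF.smooth, galilei]
  ring

lemma galilei_sum {F : Fin 3 → ℝ × E3 → ℂ} (hF : ∀ j, RapidDecay (F j)) (k : Fin 3)
    (p : ℝ × E3) : galilei k (fun q => ∑ j, F j q) p = ∑ j, galilei k (F j) p := by
  simp only [galilei, dirD_sum (fun j => (hF j).differentiable), Finset.mul_sum,
    Finset.sum_add_distrib]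

lemma galilei_const_mul {F : ℝ × E3 → ℂ} (hF : RapidDecay F) (c : ℂ) (k : Fin 3)
    (p : ℝ × E3) : galilei k (fun q => c * F q) p = c * galilei k F p := by
  simp only [galilei, dirD_const_mul hF.differentiable]; ring

lemma galilei_add {F G : ℝ × E3 → ℂ} (hF : RapidDecay F) (hG : RapidDecay G) (k : Fin 3)
    (p : ℝ × E3) : galilei k (fun q => F q + G q) p = galilei k F p + galilei k G p := by
  simp only [galilei, dirD_add hF.differentiable hG.differentiable]; ring

lemma spaceLap_galilei {F : ℝ × E3 → ℂ} (hF : RapidDecay F) (k : Fin 3) (p : ℝ × E3) :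
    spaceLap (galilei k F) p = 2 * dirD (spaceDir k) F p + galilei k (spaceLap F) p := by
  have key : ∀ j, dirD (spaceDir j) (dirD (spaceDir j) (galilei k F)) p
      = (if k = j then 2 * dirD (spaceDir j) F p else 0)
        + galilei k (dirD (spaceDir j) (dirD (spaceDir j) F)) p := fun j => by
    have e : dirD (spaceDir j) (galilei k F) = fun q =>
        (if k = j then (1:ℂ) else 0) * F q + galilei k (dirD (spaceDir j) F) q := by
      funext q
      rw [dirD_galilei hF]
      simp only [spaceDir, EuclideanSpace.single, PiLp.single_apply]
      split_ifs <;> simp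
    have hF' := hF.directional (spaceDir j)
    rw [e, dirD_add (hF.const_mul _).differentiable (hF'.galilei k).differentiable,
      dirD_const_mul hF.differentiable, dirD_galilei hF']
    by_cases h : k = j
    all_goals simp [spaceDir, h]; try ring
  rw [show galilei k (spaceLap F) p = _ from
    galilei_sum (fun j => (hF.directional (spaceDir j)).directional (spaceDir j)) k p]
  simp [spaceLap, key, Finset.sum_add_distrib]

/-- `F` solves the Schrödinger equation `i ∂ₜ F + Δ F = G`. -/
def SolvesForced (F G : ℝ × E3 → ℂ) : Prop :=
  ∀ p, dirD timeDir F p = Complex.I * spaceLap F p + (-Complex.I) * G p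

lemma SolvesForced.galilei {F G : ℝ × E3 → ℂ} (h : SolvesForced F G) (hF : RapidDecay F)
    (hG : RapidDecay G) (k : Fin 3) : SolvesForced (galilei k F) (galilei k G) := by
  intro p
  have e : dirD timeDir F = fun q => Complex.I * spaceLap F q + (-Complex.I) * G q := funext h
  rw [dirD_galilei hF, e, galilei_add (hF.spaceLap.const_mul _) (hG.const_mul _),
    galilei_const_mul hF.spaceLap, galilei_const_mul hG, spaceLap_galilei hF]
  simp [timeDir]
  ring

lemma integral_galilei_symm {F G : ℝ × E3 → ℂ} (hF : RapidDecay F) (hG : RapidDecay G)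
    (k : Fin 3) (t : ℝ) :
    ∫ x, conj (F (t, x)) * galilei k G (t, x) = ∫ x, conj (galilei k F (t, x)) * G (t, x) := by
  have h1 := (hF.star.mul (hG.galilei k)).integrable t
  have h2 := ((hF.galilei k).star.mul hG).integrable t
  rw [← sub_eq_zero, ← integral_sub h1 h2]
  have : ∀ x, conj (F (t, x)) * galilei k G (t, x) - conj (galilei k F (t, x)) * G (t, x)
      = 2 * Complex.I * t * dirD (spaceDir k) (fun q => conj (F q) * G q) (t, x) := fun x => by
    rw [dirD_mul hF.star.differentiable hG.differentiable, dirD_conj hF.differentiable]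
    simp [galilei, map_ofNat]
    ring
  simp only [this]
  rw [integral_const_mul, (hF.star.mul hG).integral_spaceDir, mul_zero]

lemma hasDerivAt_integral_norm_sq {F G : ℝ × E3 → ℂ} (h : SolvesForced F G) (hF : RapidDecay F)
    (hG : RapidDecay G) (t : ℝ) :
    HasDerivAt (fun s => ∫ x, ‖F (s, x)‖ ^ 2) (2 * (∫ x, conj (F (t, x)) * G (t, x)).im) t := by
  have hd := (hF.star.mul hF).hasDerivAt_integral t
  have hre := Complex.reCLM.hasFDerivAt.comp_hasDerivAt t hd
  have e1 : (Complex.reCLM ∘ fun s => ∫ x, conj (F (s, x)) * F (s, x))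
      = fun s => ∫ x, ‖F (s, x)‖ ^ 2 := by
    funext s
    rw [Function.comp_apply, ← Complex.reCLM.integral_comp_comm ((hF.star.mul hF).integrable s)]
    congr 1; funext x
    simp [Complex.conj_mul']
    norm_cast
  rw [e1] at hre
  refine hre.congr_deriv ?_
  have hj : ∀ j, RapidDecay (fun p => conj (F p) * dirD (spaceDir j) F p
      + (-1) * (F p * conj (dirD (spaceDir j) F p))) := fun j =>
    (hF.star.mul (hF.directional _)).add ((hF.mul (hF.directional _).star).const_mul _)
  have e2 : ∀ x, dirD timeDir (fun p => conj (F p) * F p) (t, x)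
      = Complex.I * (∑ j, dirD (spaceDir j) (fun p => conj (F p) * dirD (spaceDir j) F p
          + (-1) * (F p * conj (dirD (spaceDir j) F p))) (t, x))
        + ((2 * (conj (F (t, x)) * G (t, x)).im : ℝ) : ℂ) := fun x => by
    have e3 : ∀ j, dirD (spaceDir j) (fun p => conj (F p) * dirD (spaceDir j) F p
          + (-1) * (F p * conj (dirD (spaceDir j) F p))) (t, x)
        = conj (F (t, x)) * dirD (spaceDir j) (dirD (spaceDir j) F) (t, x)
          - F (t, x) * conj (dirD (spaceDir j) (dirD (spaceDir j) F) (t, x)) := fun j => by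
      have hd := hF.directional (spaceDir j)
      rw [dirD_add (hF.star.mul hd).differentiable
          ((hF.mul hd.star).const_mul _).differentiable,
        dirD_const_mul (hF.mul hd.star).differentiable,
        dirD_mul hF.star.differentiable hd.differentiable,
        dirD_mul hF.differentiable hd.star.differentiable, dirD_conj hF.differentiable,
        dirD_conj hd.differentiable]
      ring
    rw [dirD_mul hF.star.differentiable hF.differentiable, dirD_conj hF.differentiable, h]
    simp only [e3]
    rw [Finset.sum_sub_distrib, ← Finset.mul_sum, ← Finset.mul_sum, ← map_sum]
    change _ = Complex.I * (_ * spaceLap F (t, x) - _ * conj (spaceLap F (t, x))) + _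
    generalize spaceLap F (t, x) = L
    generalize F (t, x) = f
    generalize G (t, x) = g
    apply Complex.ext <;> simp <;> ring
  have i1 : Integrable (fun x => Complex.I * (∑ j, dirD (spaceDir j) (fun p =>
      conj (F p) * dirD (spaceDir j) F p
          + (-1) * (F p * conj (dirD (spaceDir j) F p))) (t, x))) :=
    (integrable_finsetSum _ fun j _ => ((hj j).directional (spaceDir j)).integrable t).const_mul _
  have i2 : Integrable (fun x => (2 * (conj (F (t, x)) * G (t, x)).im : ℝ)) :=
    (Complex.imCLM.integrable_comp ((hF.star.mul hG).integrable t)).const_mul 2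
  have i3 : Integrable (fun x => ((2 * (conj (F (t, x)) * G (t, x)).im : ℝ) : ℂ)) := i2.ofReal
  rw [integral_congr_ae (ae_of_all _ e2), integral_add i1 i3, integral_const_mul,
    integral_finsetSum _ fun j _ => ((hj j).directional (spaceDir j)).integrable t]
  rw [Finset.sum_eq_zero fun j _ => (hj j).integral_spaceDir t j, mul_zero, zero_add,
    integral_complex_ofReal, integral_const_mul]
  simp only [Complex.reCLM_apply, Complex.ofReal_re]
  congr 1
  exact Complex.imCLM.integral_comp_comm ((hF.star.mul hG).integrable t)

/-- A continuous function dominated by `C (1 + ‖x‖)⁻⁴`. -/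
structure BracketDom (C : ℝ) (f : E3 → ℝ) : Prop where
  cont : Continuous f
  bound : ∀ x, |f x| ≤ C * (1 + ‖x‖) ^ (-4 : ℝ)

lemma bracket_le_one (x : E3) : (1 + ‖x‖) ^ (-4 : ℝ) ≤ 1 :=
  Real.rpow_le_one_of_one_le_of_nonpos (by linarith [norm_nonneg x]) (by norm_num)

lemma BracketDom.nonneg {C : ℝ} {f : E3 → ℝ} (hf : BracketDom C f) : 0 ≤ C := by
  have := hf.bound 0
  simp at this
  exact (abs_nonneg _).trans this

lemma BracketDom.bound' {C : ℝ} {f : E3 → ℝ} (hf : BracketDom C f) (x : E3) : |f x| ≤ C :=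
  (hf.bound x).trans (mul_le_of_le_one_right hf.nonneg (bracket_le_one x))

lemma BracketDom.mono {C D : ℝ} {f : E3 → ℝ} (hf : BracketDom C f) (h : C ≤ D) : BracketDom D f :=
  ⟨hf.cont, fun x => (hf.bound x).trans (mul_le_mul_of_nonneg_right h (by positivity))⟩

lemma BracketDom.integrable {C : ℝ} {f : E3 → ℝ} (hf : BracketDom C f) : Integrable f :=
  (integrable_bracket.const_mul C).mono' hf.cont.aestronglyMeasurable (ae_of_all _ hf.bound)

/-- The bilinear form `∬ v(z) h(x) f(x - z) dx dz`. -/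
def pairForm (v h f : E3 → ℝ) : ℝ := ∫ q : E3 × E3, v q.1 * (h q.2 * f (q.2 - q.1))

section pairing

variable {v h f : E3 → ℝ} {C D : ℝ}

lemma integrable_pair (hv : Integrable v) (hh : BracketDom C h) (hf : BracketDom D f) :
    Integrable (fun q : E3 × E3 => v q.1 * (h q.2 * f (q.2 - q.1))) := by
  have h1 : Integrable (fun q : E3 × E3 => v q.1 * h q.2) := hv.mul_prod hh.integrable
  have h2 : Continuous (fun q : E3 × E3 => f (q.2 - q.1)) := hf.cont.comp (by fun_prop)
  simpa [mul_assoc] using h1.mul_bdd (c := D) h2.aestronglyMeasurable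
    (ae_of_all _ fun q => hf.bound' _)

lemma pairForm_eq (hv : Integrable v) (hh : BracketDom C h) (hf : BracketDom D f) :
    pairForm v h f = ∫ x, h x * ∫ z, v z * f (x - z) := by
  rw [pairForm, Measure.volume_eq_prod, integral_prod_symm _ (integrable_pair hv hh hf)]
  congr 1; funext x
  rw [← integral_const_mul]
  congr 1; funext z; ring

lemma pairForm_eq' (hv : Integrable v) (hh : BracketDom C h) (hf : BracketDom D f) :
    pairForm v h f = ∫ z, v z * ∫ x, h x * f (x - z) := by
  rw [pairForm, Measure.volume_eq_prod, integral_prod _ (integrable_pair hv hh hf)]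
  congr 1; funext x
  rw [← integral_const_mul]

lemma pairForm_symm (hv : Integrable v) (heven : ∀ z, v (-z) = v z)
    (hh : BracketDom C h) (hf : BracketDom D f) : pairForm v h f = pairForm v f h := by
  rw [pairForm_eq' hv hh hf, pairForm_eq' hv hf hh,
    ← integral_neg_eq_self (fun z => v z * ∫ x, h x * f (x - z))]
  congr 1; funext z
  rw [heven, ← integral_sub_right_eq_self (fun x => h x * f (x - -z)) z]
  congr 2; funext x
  simp [mul_comm]

lemma pairForm_le (hv : Integrable v) (hv0 : ∀ z, 0 ≤ v z) (hf : BracketDom C f) :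
    pairForm v f f ≤ (∫ z, v z) * ∫ x, f x ^ 2 := by
  rw [pairForm_eq' hv hf hf, ← integral_mul_const]
  have hsq : Integrable (fun x => f x ^ 2) := by
    simpa [sq] using hf.integrable.mul_bdd (c := C) hf.cont.aestronglyMeasurable
      (ae_of_all _ fun q => hf.bound' _)
  have i1 : Integrable (fun z => v z * ∫ x, f x * f (x - z)) := by
    simpa only [integral_const_mul] using (integrable_pair hv hf hf).integral_prod_left
  refine integral_mono i1 (hv.mul_const _) fun z => mul_le_mul_of_nonneg_left ?_ (hv0 z)
  have hsq' : Integrable (fun x => f (x - z) ^ 2) := hsq.comp_sub_right z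
  have hp : Integrable (fun x => f x * f (x - z)) :=
    hf.integrable.mul_bdd (c := C) (hf.cont.comp (by fun_prop)).aestronglyMeasurable
      (ae_of_all _ fun q => hf.bound' _)
  calc ∫ x, f x * f (x - z) ≤ ∫ x, (1 / 2 * f x ^ 2 + 1 / 2 * f (x - z) ^ 2) :=
        integral_mono hp ((hsq.const_mul _).add (hsq'.const_mul _)) fun x => by
          simp only
          nlinarith [sq_nonneg (f x - f (x - z))]
    _ = ∫ x, f x ^ 2 := by
        rw [integral_add (hsq.const_mul _) (hsq'.const_mul _), integral_const_mul,
          integral_const_mul, integral_sub_right_eq_self (fun x => f x ^ 2) z]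
        ring

lemma pairForm_hasDerivAt {F F' : ℝ → E3 → ℝ} {s₀ ε : ℝ} (hε : 0 < ε) (hv : Integrable v)
    (heven : ∀ z, v (-z) = v z)
    (hF : ∀ s ∈ Metric.ball s₀ ε, BracketDom C (F s))
    (hF' : ∀ s ∈ Metric.ball s₀ ε, BracketDom C (F' s))
    (hd : ∀ s ∈ Metric.ball s₀ ε, ∀ x, HasDerivAt (fun r => F r x) (F' s x) s) :
    HasDerivAt (fun s => pairForm v (F s) (F s)) (2 * pairForm v (F' s₀) (F s₀)) s₀ := by
  have m0 : s₀ ∈ Metric.ball s₀ ε := Metric.mem_ball_self hε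
  have i1 := integrable_pair hv (hF' s₀ m0) (hF s₀ m0)
  have i2 := integrable_pair hv (hF s₀ m0) (hF' s₀ m0)
  have key := (hasDerivAt_integral_of_dominated_loc_of_deriv_le
    (μ := (volume : Measure (E3 × E3)))
    (F := fun s (q : E3 × E3) => v q.1 * (F s q.2 * F s (q.2 - q.1)))
    (F' := fun s (q : E3 × E3) => v q.1 * (F' s q.2 * F s (q.2 - q.1))
      + v q.1 * (F s q.2 * F' s (q.2 - q.1)))
    (bound := fun q => |v q.1| * ((C * (1 + ‖q.2‖) ^ (-4 : ℝ)) * (2 * C)))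
    (Metric.ball_mem_nhds s₀ hε)
    (Filter.eventually_of_mem (Metric.ball_mem_nhds s₀ hε)
      fun s hs => (integrable_pair hv (hF s hs) (hF s hs)).1)
    (integrable_pair hv (hF s₀ m0) (hF s₀ m0)) (i1.add i2).1
    (ae_of_all _ fun q s hs => ?_) ?_ (ae_of_all _ fun q s hs => ?_)).2
  · refine key.congr_deriv ?_
    rw [integral_add i1 i2]
    change pairForm v (F' s₀) (F s₀) + pairForm v (F s₀) (F' s₀) = _
    rw [pairForm_symm hv heven (hF s₀ m0) (hF' s₀ m0)]
    ring
  · have a1 := (hF s hs).bound q.2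
    have a2 := (hF' s hs).bound q.2
    have a3 := (hF s hs).bound' (q.2 - q.1)
    have a4 := (hF' s hs).bound' (q.2 - q.1)
    rw [← mul_add, norm_mul, Real.norm_eq_abs, Real.norm_eq_abs]
    refine mul_le_mul_of_nonneg_left ((abs_add_le _ _).trans ?_) (abs_nonneg _)
    rw [abs_mul, abs_mul]
    calc _ ≤ (C * (1 + ‖q.2‖) ^ (-4 : ℝ)) * C + (C * (1 + ‖q.2‖) ^ (-4 : ℝ)) * C :=
          add_le_add (mul_le_mul a2 a3 (abs_nonneg _) ((abs_nonneg _).trans a1))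
            (mul_le_mul a1 a4 (abs_nonneg _) ((abs_nonneg _).trans a1))
      _ = _ := by ring
  · exact hv.abs.mul_prod ((integrable_bracket.const_mul C).mul_const (2 * C))
  · have := (((hd s hs q.2).mul (hd s hs (q.2 - q.1)))).const_mul (v q.1)
    rw [mul_add] at this
    exact this

end pairing

section potential

variable {χ : ℝ → ℝ}

/-- The truncated Coulomb potential `χ(|z|)/|z|`. -/
def coulombPot (χ : ℝ → ℝ) (z : E3) : ℝ := χ ‖z‖ / ‖z‖

lemma coulombPot_nonneg (hχ : IsCutoff χ) (z : E3) : 0 ≤ coulombPot χ z :=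
  div_nonneg (hχ.nonneg _) (norm_nonneg _)

lemma coulombPot_even (z : E3) : coulombPot χ (-z) = coulombPot χ z := by simp [coulombPot]

lemma integrable_coulombPot (hχ : IsCutoff χ) : Integrable (coulombPot χ) := by
  have := (integrable_fun_norm_addHaar (E := E3) volume (f := fun r => χ r / r)).2 (by
    have h1 : Integrable (fun y : ℝ => y * χ y) :=
      (continuous_id.mul hχ.smooth.continuous).integrable_of_hasCompactSupport
        hχ.compact_supp.mul_left
    refine (h1.integrableOn (s := Set.Ioi 0)).congr_fun (fun y hy => ?_) measurableSet_Ioi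
    have hy : y ≠ 0 := (Set.mem_Ioi.1 hy).ne'
    simp
    field_simp)
  exact this

lemma coulombPot_dilate (hχ : IsCutoff χ) {l : ℝ} (hl : 1 ≤ l) (z : E3) :
    l * coulombPot χ z ≤ coulombPot χ (l⁻¹ • z) := by
  have hl0 : 0 < l := by linarith
  have h1 : χ ‖z‖ ≤ χ (l⁻¹ * ‖z‖) := hχ.mono (Set.mem_Ici.2 (by positivity))
    (Set.mem_Ici.2 (by positivity)) (mul_le_of_le_one_left (by positivity) (inv_le_one_of_one_le₀ hl))
  have h2 : coulombPot χ (l⁻¹ • z) = l * (χ (l⁻¹ * ‖z‖) / ‖z‖) := by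
    simp only [coulombPot, norm_smul, norm_inv, Real.norm_eq_abs, abs_of_pos hl0]
    by_cases hz : ‖z‖ = 0
    · simp [hz]
    · field_simp
  rw [h2, coulombPot]
  gcongr

lemma pairForm_dilate (hχ : IsCutoff χ) {f : E3 → ℝ} {C : ℝ} (hf : BracketDom C f)
    (hf0 : ∀ x, 0 ≤ f x) {l : ℝ} (hl : 1 ≤ l) :
    pairForm (coulombPot χ) f f ≤
      l ^ 5 * pairForm (coulombPot χ) (fun x => f (l • x)) (fun x => f (l • x)) := by
  have hl0 : 0 < l := by linarith
  have hv' : Integrable (fun z => coulombPot χ (l⁻¹ • z)) :=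
    (integrable_coulombPot hχ).comp_smul (inv_ne_zero hl0.ne')
  have e : pairForm (coulombPot χ) (fun x => f (l • x)) (fun x => f (l • x))
      = (l ^ 6)⁻¹ * pairForm (fun z => coulombPot χ (l⁻¹ • z)) f f := by
    have := Measure.integral_comp_smul ((volume : Measure E3).prod volume)
      (fun q => coulombPot χ (l⁻¹ • q.1) * (f q.2 * f (q.2 - q.1))) l
    simp only [Prod.smul_fst, Prod.smul_snd, smul_smul, inv_mul_cancel₀ hl0.ne', one_smul,
      ← smul_sub] at this
    rw [pairForm, Measure.volume_eq_prod, this, pairForm]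
    simp [abs_of_pos hl0, Measure.volume_eq_prod]
  have h3 : l * pairForm (coulombPot χ) f f ≤ pairForm (fun z => coulombPot χ (l⁻¹ • z)) f f := by
    rw [pairForm, pairForm, ← integral_const_mul]
    refine integral_mono ((integrable_pair (integrable_coulombPot hχ) hf hf).const_mul l)
      (integrable_pair hv' hf hf) fun q => ?_
    simp only
    rw [← mul_assoc]
    exact mul_le_mul_of_nonneg_right (coulombPot_dilate hχ hl q.1)
      (mul_nonneg (hf0 _) (hf0 _))
  rw [e]
  have : l ^ 5 * ((l ^ 6)⁻¹ * pairForm (fun z => coulombPot χ (l⁻¹ • z)) f f)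
      = l⁻¹ * pairForm (fun z => coulombPot χ (l⁻¹ • z)) f f := by field_simp
  rw [this, le_inv_mul_iff₀ hl0]
  exact h3

/-- If `f'` is the dilation derivative of `f` at `1`, the virial quantity is controlled. -/
lemma pairForm_virial (hχ : IsCutoff χ) {f : E3 → ℝ} {C : ℝ} (hf : BracketDom C f)
    (hf0 : ∀ x, 0 ≤ f x) {d : ℝ}
    (hd : HasDerivAt (fun l : ℝ => pairForm (coulombPot χ) (fun x => f (l • x))
      (fun x => f (l • x))) d 1) :
    0 ≤ 5 * pairForm (coulombPot χ) f f + d := by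
  have h1 := ((hasDerivAt_pow 5 (1:ℝ)).fun_mul hd)
  have h2 := (hasDerivWithinAt_iff_tendsto_slope' (by simp)).1 (h1.hasDerivWithinAt (s := Set.Ioi 1))
  have h3 := ge_of_tendsto h2 (b := 0) (by
    filter_upwards [self_mem_nhdsWithin] with l hl
    rw [slope_def_field]
    refine div_nonneg (sub_nonneg.2 ?_) (sub_nonneg.2 (le_of_lt hl))
    simpa using pairForm_dilate hχ hf hf0 (le_of_lt hl))
  simpa using h3

end potential

/-- The real number `2 Re (conj F · H)` at a space-time point. -/
def twoRe (F H : ℝ × E3 → ℂ) (p : ℝ × E3) : ℝ := 2 * (conj (F p) * H p).re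

/-- The Euler operator `x · ∇`. -/
def euler (F : ℝ × E3 → ℂ) (p : ℝ × E3) : ℂ := ∑ k, (p.2 k : ℂ) * dirD (spaceDir k) F p

lemma RapidDecay.euler {F : ℝ × E3 → ℂ} (hF : RapidDecay F) : RapidDecay (euler F) :=
  RapidDecay.sum fun k => (hF.directional (spaceDir k)).coord_mul k

lemma RapidDecay.twoRe_bracketDom {F H : ℝ × E3 → ℂ} (hF : RapidDecay F) (hH : RapidDecay H)
    (T : ℝ) : ∃ C : ℝ, ∀ t, |t| ≤ T → BracketDom C (fun x => twoRe F H (t, x)) := by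
  obtain ⟨C, h0, hC⟩ := (hF.star.mul hH).bound T
  refine ⟨2 * C, fun t ht => ⟨?_, fun x => ?_⟩⟩
  · exact continuous_const.mul (Complex.continuous_re.comp ((hF.star.mul hH).continuous_slice t))
  · rw [twoRe, abs_mul, abs_two, mul_assoc]
    exact mul_le_mul_of_nonneg_left ((Complex.abs_re_le_norm _).trans (hC t x ht)) zero_le_two

lemma RapidDecay.normSq_bracketDom {F : ℝ × E3 → ℂ} (hF : RapidDecay F) (T : ℝ) :
    ∃ C : ℝ, ∀ t, |t| ≤ T → BracketDom C (fun x => ‖F (t, x)‖ ^ 2) := by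
  obtain ⟨C, h0, hC⟩ := (hF.star.mul hF).bound T
  refine ⟨C, fun t ht => ⟨(hF.continuous_slice t).norm.pow 2, fun x => ?_⟩⟩
  have := hC t x ht
  simpa [abs_of_nonneg, sq] using this

lemma hasDerivAt_norm_sq_comp {f : ℝ → ℂ} {f' : ℂ} {s : ℝ} (hf : HasDerivAt f f' s) :
    HasDerivAt (fun r => ‖f r‖ ^ 2) (2 * (conj (f s) * f').re) s := by
  have := hf.norm_sq
  refine this.congr_deriv ?_
  simp [Complex.inner, mul_comm]

lemma hasDerivAt_dilate {F : ℝ × E3 → ℂ} (hF : Differentiable ℝ F) (t : ℝ) (x : E3) {s : ℝ}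
    (hs : s ≠ 0) :
    HasDerivAt (fun r : ℝ => F (t, r • x)) ((s : ℂ)⁻¹ * euler F (t, s • x)) s := by
  have h1 := (hasFDerivAt_slice hF t (s • x)).comp_hasDerivAt s
    ((hasDerivAt_id s).smul_const x)
  refine h1.congr_deriv ?_
  have hx : ((0 : ℝ), x) = ∑ k, x k • spaceDir k := by
    ext i
    · simp [spaceDir, Prod.fst_sum]
    · simp [spaceDir, Prod.snd_sum, Pi.single_apply]
  have hs' : (s : ℂ) ≠ 0 := by exact_mod_cast hs
  simp only [one_smul, ContinuousLinearMap.comp_apply, ContinuousLinearMap.inr_apply, hx, map_sum,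
    map_smul, euler, Finset.mul_sum]
  refine Finset.sum_congr rfl fun k _ => ?_
  simp only [dirD, PiLp.smul_apply, smul_eq_mul, Complex.ofReal_mul, Complex.real_smul]
  field_simp

lemma integrable_mul_average {v h f : E3 → ℝ} {C D : ℝ} (hv : Integrable v)
    (hh : BracketDom C h) (hf : BracketDom D f) :
    Integrable (fun x => h x * ∫ z, v z * f (x - z)) := by
  refine (integrable_pair hv hh hf).integral_prod_right.congr (ae_of_all _ fun x => ?_)
  simp only
  rw [← integral_const_mul]
  congr 1; funext z; ring

/-- `F` solves the Hartree equation for the truncated Coulomb potential, `G` being the product of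
the self-interaction potential with `F`. -/
structure HartreeFlow (χ : ℝ → ℝ) (F G : ℝ × E3 → ℂ) : Prop where
  cutoff : IsCutoff χ
  rapid : RapidDecay F
  rapid_force : RapidDecay G
  solves : SolvesForced F G
  force : ∀ t x, G (t, x)
    = ((∫ z, coulombPot χ z * ‖F (t, x - z)‖ ^ 2 : ℝ) : ℂ) * F (t, x)

/-- The interaction energy. -/
def interaction (χ : ℝ → ℝ) (F : ℝ × E3 → ℂ) (t : ℝ) : ℝ :=
  pairForm (coulombPot χ) (fun x => ‖F (t, x)‖ ^ 2) (fun x => ‖F (t, x)‖ ^ 2)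

/-- The kinetic part of the pseudoconformal energy. -/
def galileiEnergy (F : ℝ × E3 → ℂ) (t : ℝ) : ℝ := ∑ k, ∫ x, ‖galilei k F (t, x)‖ ^ 2

/-- The pseudoconformal energy. -/
def confEnergy (χ : ℝ → ℝ) (F : ℝ × E3 → ℂ) (t : ℝ) : ℝ :=
  galileiEnergy F t + 2 * t ^ 2 * interaction χ F t

section flow

variable {χ : ℝ → ℝ} {F G : ℝ × E3 → ℂ}

lemma HartreeFlow.mass_conserved (h : HartreeFlow χ F G) (s t : ℝ) :
    ∫ x, ‖F (s, x)‖ ^ 2 = ∫ x, ‖F (t, x)‖ ^ 2 := by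
  have hd : ∀ t, HasDerivAt (fun s => ∫ x, ‖F (s, x)‖ ^ 2) 0 t := fun t => by
    refine (hasDerivAt_integral_norm_sq h.solves h.rapid h.rapid_force t).congr_deriv ?_
    have : ∀ x, conj (F (t, x)) * G (t, x)
        = (((∫ z, coulombPot χ z * ‖F (t, x - z)‖ ^ 2) * ‖F (t, x)‖ ^ 2 : ℝ) : ℂ) := fun x => by
      rw [h.force, Complex.ofReal_mul, Complex.ofReal_pow, ← Complex.conj_mul']
      ring
    simp only [this]
    rw [integral_complex_ofReal, Complex.ofReal_im, mul_zero]
  exact is_const_of_deriv_eq_zero (fun t => (hd t).differentiableAt) (fun t => (hd t).deriv) s t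

lemma HartreeFlow.hasDerivAt_interaction (h : HartreeFlow χ F G) (t : ℝ) :
    HasDerivAt (interaction χ F) (2 * pairForm (coulombPot χ)
      (fun x => twoRe F (dirD timeDir F) (t, x)) (fun x => ‖F (t, x)‖ ^ 2)) t := by
  obtain ⟨C, hC⟩ := h.rapid.normSq_bracketDom (|t| + 1)
  obtain ⟨D, hD⟩ := h.rapid.twoRe_bracketDom (h.rapid.directional timeDir) (|t| + 1)
  have hb : ∀ s ∈ Metric.ball t 1, |s| ≤ |t| + 1 := fun s hs => by
    rw [Metric.mem_ball, Real.dist_eq] at hs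
    linarith [abs_sub_abs_le_abs_sub s t]
  exact pairForm_hasDerivAt (C := max C D)
    (F := fun s x => ‖F (s, x)‖ ^ 2) (F' := fun s x => twoRe F (dirD timeDir F) (s, x))
    one_pos (integrable_coulombPot h.cutoff) coulombPot_even
    (fun s hs => (hC s (hb s hs)).mono (le_max_left _ _))
    (fun s hs => (hD s (hb s hs)).mono (le_max_right _ _))
    (fun s _ x => hasDerivAt_norm_sq_comp (hasDerivAt_time h.rapid.differentiable s x))

lemma HartreeFlow.virial (h : HartreeFlow χ F G) (t : ℝ) :
    0 ≤ 5 * interaction χ F t + 2 * pairForm (coulombPot χ)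
      (fun x => twoRe F (euler F) (t, x)) (fun x => ‖F (t, x)‖ ^ 2) := by
  obtain ⟨C, hC⟩ := h.rapid.normSq_bracketDom |t|
  obtain ⟨D, hD⟩ := h.rapid.twoRe_bracketDom h.rapid.euler |t|
  have hC := hC t le_rfl
  have hD := hD t le_rfl
  have hb : ∀ s ∈ Metric.ball (1:ℝ) (1/2), 1/2 ≤ s ∧ s⁻¹ ≤ 2 := fun s hs => by
    rw [Metric.mem_ball, Real.dist_eq, abs_lt] at hs
    have : 1/2 ≤ s := by linarith
    exact ⟨this, by rw [inv_le_comm₀ (by linarith) (by norm_num)]; linarith⟩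
  have hdil : ∀ {c : ℝ} {f : E3 → ℝ}, BracketDom c f → ∀ s ∈ Metric.ball (1:ℝ) (1/2),
      BracketDom (16 * c) (fun x => f (s • x)) := fun {c f} hf s hs => by
    refine ⟨hf.cont.comp (continuous_const_smul s), fun x => (hf.bound _).trans ?_⟩
    rw [mul_assoc, mul_left_comm]
    refine mul_le_mul_of_nonneg_left ?_ hf.nonneg
    have h1 : (1/2) * (1 + ‖x‖) ≤ 1 + ‖s • x‖ := by
      rw [norm_smul, Real.norm_eq_abs, abs_of_nonneg (by linarith [(hb s hs).1])]
      nlinarith [(hb s hs).1, norm_nonneg x]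
    calc _ ≤ ((1/2) * (1 + ‖x‖)) ^ (-4:ℝ) :=
          Real.rpow_le_rpow_of_nonpos (by positivity) h1 (by norm_num)
      _ = 16 * (1 + ‖x‖) ^ (-4:ℝ) := by
          rw [Real.mul_rpow (by norm_num) (by positivity)]
          norm_num [Real.rpow_neg]
  have key := pairForm_hasDerivAt (v := coulombPot χ) (C := max (16 * C) (2 * (16 * D)))
    (F := fun s x => ‖F (t, s • x)‖ ^ 2) (F' := fun s x => s⁻¹ * twoRe F (euler F) (t, s • x))
    (s₀ := 1) (ε := 1/2) (by norm_num) (integrable_coulombPot h.cutoff) coulombPot_even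
    (fun s hs => (hdil hC s hs).mono (le_max_left _ _))
    (fun s hs => BracketDom.mono ?_ (le_max_right _ _))
    (fun s hs x => ?_)
  · simp only [inv_one, one_mul, one_smul] at key
    exact pairForm_virial h.cutoff hC (fun x => by positivity) key
  · refine ⟨continuous_const.mul (hdil hD s hs).cont, fun x => ?_⟩
    rw [abs_mul, mul_assoc 2]
    have : |s⁻¹| ≤ 2 := by
      rw [abs_of_nonneg (inv_nonneg.2 (by linarith [(hb s hs).1]))]; exact (hb s hs).2
    exact mul_le_mul this ((hdil hD s hs).bound x) (abs_nonneg _) zero_le_two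
  · have hs0 : s ≠ 0 := by linarith [(hb s hs).1]
    refine (hasDerivAt_norm_sq_comp (hasDerivAt_dilate h.rapid.differentiable t x hs0)).congr_deriv
      ?_
    rw [twoRe, mul_left_comm (conj _), ← Complex.ofReal_inv, Complex.re_ofReal_mul]
    ring

lemma HartreeFlow.galilei_sq_im (h : HartreeFlow χ F G) (t : ℝ) (x : E3) :
    ∑ k, (conj (galilei k (galilei k F) (t, x)) * F (t, x)).im
      = -6 * t * ‖F (t, x)‖ ^ 2 + -2 * t * twoRe F (euler F) (t, x)
        + -2 * t ^ 2 * twoRe F (dirD timeDir F) (t, x) := by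
  have e : ∀ k, galilei k (galilei k F) (t, x) = (x k : ℂ) ^ 2 * F (t, x)
      + 2 * Complex.I * t * F (t, x) + 4 * Complex.I * t * (x k * dirD (spaceDir k) F (t, x))
      - 4 * t ^ 2 * dirD (spaceDir k) (dirD (spaceDir k) F) (t, x) := fun k => by
    rw [show galilei k (galilei k F) (t, x) = (x k : ℂ) * galilei k F (t, x)
      + (2 * Complex.I) * (t * dirD (spaceDir k) (galilei k F) (t, x)) from rfl,
      dirD_galilei h.rapid, show (spaceDir k).2 k = 1 by simp [spaceDir],
      show (spaceDir k).1 = 0 from rfl]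
    simp only [galilei]
    push_cast
    linear_combination (4 * t ^ 2 * dirD (spaceDir k) (dirD (spaceDir k) F) (t, x)) * Complex.I_sq
  have e2 := h.solves (t, x)
  rw [h.force] at e2
  simp only [twoRe, e2, e, spaceLap, euler, Fin.sum_univ_three]
  rw [← Complex.normSq_eq_norm_sq, Complex.normSq_apply]
  simp [-Complex.ofReal_pow, pow_two]
  ring

lemma HartreeFlow.hasDerivAt_galileiEnergy (h : HartreeFlow χ F G) (t : ℝ) :
    HasDerivAt (galileiEnergy F) (-12 * t * interaction χ F t
      - 4 * t * pairForm (coulombPot χ) (fun x => twoRe F (euler F) (t, x))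
          (fun x => ‖F (t, x)‖ ^ 2)
      - 4 * t ^ 2 * pairForm (coulombPot χ) (fun x => twoRe F (dirD timeDir F) (t, x))
          (fun x => ‖F (t, x)‖ ^ 2)) t := by
  obtain ⟨C, hC⟩ := h.rapid.normSq_bracketDom |t|
  obtain ⟨D, hD⟩ := h.rapid.twoRe_bracketDom h.rapid.euler |t|
  obtain ⟨D', hD'⟩ := h.rapid.twoRe_bracketDom (h.rapid.directional timeDir) |t|
  have hC := hC t le_rfl
  have hD := hD t le_rfl
  have hD' := hD' t le_rfl
  have hv := integrable_coulombPot h.cutoff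
  have h1 := HasDerivAt.fun_sum (u := Finset.univ) fun k _ => hasDerivAt_integral_norm_sq
    (h.solves.galilei h.rapid h.rapid_force k) (h.rapid.galilei k) (h.rapid_force.galilei k) t
  refine h1.congr_deriv ?_
  simp only [integral_galilei_symm (h.rapid.galilei _) h.rapid_force]
  have hi : ∀ k, Integrable (fun x => conj (galilei k (galilei k F) (t, x)) * G (t, x)) :=
    fun k => (((h.rapid.galilei k).galilei k).star.mul h.rapid_force).integrable t
  have him : ∀ k, (∫ x, conj (galilei k (galilei k F) (t, x)) * G (t, x)).im
      = ∫ x, (conj (galilei k (galilei k F) (t, x)) * G (t, x)).im := fun k =>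
    (integral_im (hi k)).symm
  rw [← Finset.mul_sum]
  simp only [him]
  rw [← integral_finsetSum _ fun k _ => show Integrable (fun x =>
    (conj (galilei k (galilei k F) (t, x)) * G (t, x)).im) from (hi k).im]
  have e : ∀ x, ∑ k, (conj (galilei k (galilei k F) (t, x)) * G (t, x)).im
      = -6 * t * (‖F (t, x)‖ ^ 2 * ∫ z, coulombPot χ z * ‖F (t, x - z)‖ ^ 2)
        + -2 * t * (twoRe F (euler F) (t, x) * ∫ z, coulombPot χ z * ‖F (t, x - z)‖ ^ 2)
        + -2 * t ^ 2 * (twoRe F (dirD timeDir F) (t, x)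
          * ∫ z, coulombPot χ z * ‖F (t, x - z)‖ ^ 2) := fun x => by
    simp only [h.force, mul_left_comm (conj _), Complex.im_ofReal_mul]
    rw [← Finset.mul_sum, h.galilei_sq_im]
    ring
  simp only [e]
  rw [integral_add, integral_add, integral_const_mul, integral_const_mul, integral_const_mul,
    ← pairForm_eq hv hC hC, ← pairForm_eq hv hD hC, ← pairForm_eq hv hD' hC, interaction]
  · ring
  · exact (integrable_mul_average hv hC hC).const_mul _
  · exact (integrable_mul_average hv hD hC).const_mul _
  · exact ((integrable_mul_average hv hC hC).const_mul _).add
      ((integrable_mul_average hv hD hC).const_mul _)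
  · exact (integrable_mul_average hv hD' hC).const_mul _

lemma HartreeFlow.interaction_nonneg (h : HartreeFlow χ F G) (t : ℝ) : 0 ≤ interaction χ F t :=
  integral_nonneg fun q => mul_nonneg (coulombPot_nonneg h.cutoff _) (by positivity)

lemma galileiEnergy_nonneg (t : ℝ) : 0 ≤ galileiEnergy F t :=
  Finset.sum_nonneg fun _ _ => integral_nonneg fun _ => by positivity

lemma HartreeFlow.hasDerivAt_confEnergy (h : HartreeFlow χ F G) (t : ℝ) (ht : 0 ≤ t) :
    ∃ d, HasDerivAt (confEnergy χ F) d t ∧ d ≤ 2 * t * interaction χ F t := by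
  refine ⟨_, (h.hasDerivAt_galileiEnergy t).add
    ((((hasDerivAt_pow 2 t).const_mul 2)).mul (h.hasDerivAt_interaction t)), ?_⟩
  have := mul_nonneg ht (h.virial t)
  push_cast
  nlinarith

end flow

lemma norm_fderiv_cutoff_le {η : E3 → ℝ} {u : E3 → ℂ} (hη : Differentiable ℝ η)
    (hu : Differentiable ℝ u) (h1 : ∀ x, |η x| ≤ 1) {M : ℝ} (hM : ∀ x, ‖fderiv ℝ η x‖ ≤ M)
    (c : ℝ) (x : E3) :
    ‖fderiv ℝ (fun y => η (c • y) • u y) x‖ ≤ ‖‖fderiv ℝ u x‖ + (|c| * M) * ‖u x‖‖ := by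
  have hM0 : 0 ≤ M := (norm_nonneg _).trans (hM 0)
  have d1 : HasFDerivAt (fun y => η (c • y))
      ((fderiv ℝ η (c • x)).comp (c • ContinuousLinearMap.id ℝ E3)) x :=
    (hη (c • x)).hasFDerivAt.comp x ((hasFDerivAt_id x).const_smul c)
  rw [(d1.fun_smul (hu x).hasFDerivAt).fderiv, Real.norm_of_nonneg (by positivity)]
  refine (norm_add_le _ _).trans (add_le_add ?_ ?_)
  · rw [norm_smul]
    exact mul_le_of_le_one_left (norm_nonneg _) (h1 _)
  · rw [ContinuousLinearMap.norm_smulRight_apply]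
    refine mul_le_mul_of_nonneg_right ?_ (norm_nonneg _)
    refine (ContinuousLinearMap.opNorm_comp_le _ _).trans ?_
    rw [norm_smul, mul_comm, Real.norm_eq_abs]
    have := ContinuousLinearMap.norm_id_le (𝕜 := ℝ) (E := E3)
    have h2 := hM (c • x)
    calc |c| * ‖ContinuousLinearMap.id ℝ E3‖ * ‖fderiv ℝ η (c • x)‖
        ≤ |c| * 1 * M := by gcongr
      _ = |c| * M := by ring

/-- The Gagliardo–Nirenberg–Sobolev inequality in dimension three. -/
lemma exists_sobolev_const : ∃ K : NNReal, ∀ w : E3 → ℂ, ContDiff ℝ 1 w → HasCompactSupport w →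
    eLpNorm w 6 ≤ K * eLpNorm (fderiv ℝ w) 2 :=
  ⟨_, fun _ hw hws => eLpNorm_le_eLpNorm_fderiv_of_eq_inner (volume : Measure E3) (p := 2)
    (p' := 6) hw hws (by norm_num) (by simp) (by simp; norm_num)⟩

lemma eLpNorm_cutoff_six_le {η : E3 → ℝ} {u : E3 → ℂ} (hη : ContDiff ℝ 1 η)
    (hηs : HasCompactSupport η) (hu : ContDiff ℝ 1 u) (h1 : ∀ x, |η x| ≤ 1) {M : ℝ}
    (hM : ∀ x, ‖fderiv ℝ η x‖ ≤ M) {c : ℝ} (hc : c ≠ 0) {K : NNReal}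
    (hK : ∀ w : E3 → ℂ, ContDiff ℝ 1 w → HasCompactSupport w →
      eLpNorm w 6 ≤ K * eLpNorm (fderiv ℝ w) 2) :
    eLpNorm (fun x => η (c • x) • u x) 6
      ≤ K * (eLpNorm (fderiv ℝ u) 2
        + ENNReal.ofReal (|c| * M) * eLpNorm u 2) := by
  have hM0 : 0 ≤ M := (norm_nonneg _).trans (hM 0)
  have hw : ContDiff ℝ 1 (fun x => η (c • x) • u x) :=
    (hη.comp (contDiff_const_smul c)).smul hu
  have hws : HasCompactSupport (fun x => η (c • x) • u x) :=
    HasCompactSupport.smul_right (f := fun x => η (c • x)) (hηs.comp_smul hc)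
  refine (hK _ hw hws).trans (mul_le_mul_right ?_ _)
  have hd : Continuous (fderiv ℝ u) := hu.continuous_fderiv one_ne_zero
  have e := eLpNorm_const_smul (|c| * M) (fun x => ‖u x‖) (2 : ENNReal) (volume : Measure E3)
  rw [Real.enorm_eq_ofReal (by positivity), eLpNorm_norm] at e
  have h2 := eLpNorm_mono (p := 2) (μ := (volume : Measure E3))
    (g := fun x => ‖fderiv ℝ u x‖ + (|c| * M) * ‖u x‖)
    (norm_fderiv_cutoff_le (hη.differentiable one_ne_zero) (hu.differentiable one_ne_zero)
      h1 hM c)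
  have h3 := eLpNorm_add_le (p := 2) (μ := (volume : Measure E3))
    (f := fun x => ‖fderiv ℝ u x‖) (g := (|c| * M) • fun x => ‖u x‖) hd.norm.aestronglyMeasurable
    (hu.continuous.norm.const_smul _).aestronglyMeasurable (by norm_num)
  rw [e, eLpNorm_norm] at h3
  exact h2.trans h3

lemma exists_cutoff : ∃ η : E3 → ℝ, ContDiff ℝ 1 η ∧ HasCompactSupport η ∧ (∀ x, |η x| ≤ 1) ∧
    η 0 = 1 := by
  have η : ContDiffBump (0 : E3) := Classical.arbitrary _
  refine ⟨η, η.contDiff, η.hasCompactSupport, fun x => ?_, η.eventuallyEq_one.eq_of_nhds⟩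
  rw [abs_of_nonneg η.nonneg]
  exact η.le_one

/-- The Sobolev inequality for square integrable functions that need not have compact support. -/
lemma exists_eLpNorm_six_le_fderiv : ∃ K : NNReal, ∀ u : E3 → ℂ, ContDiff ℝ 1 u → MemLp u 2 →
    eLpNorm u 6 ≤ K * eLpNorm (fderiv ℝ u) 2 := by
  obtain ⟨K, hK⟩ := exists_sobolev_const
  refine ⟨K, fun u hu h2 => ?_⟩
  obtain ⟨η, hη, hηs, hbd, hη0⟩ := exists_cutoff
  obtain ⟨M, hM⟩ := (hη.continuous_fderiv one_ne_zero).bounded_above_of_compact_support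
    (hηs.fderiv ℝ)
  obtain ⟨c, hc, hc0⟩ : ∃ c : ℕ → ℝ, (∀ n, c n ≠ 0) ∧ Filter.Tendsto c Filter.atTop (nhds 0) :=
    ⟨fun n => 1 / ((n : ℝ) + 1), fun n => by positivity, tendsto_one_div_add_atTop_nhds_zero_nat⟩
  have hb := fun n => eLpNorm_cutoff_six_le hη hηs hu hbd hM (hc n) hK
  have hlim : ∀ x, Filter.Tendsto (fun n => η (c n • x) • u x) Filter.atTop (nhds (u x)) :=
      fun x => by
    have h0 := hc0.smul_const x
    rw [zero_smul] at h0
    have h1 := (hη.continuous.tendsto 0).comp h0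
    rw [hη0] at h1
    simpa using h1.smul_const (u x)
  have hl := Lp.eLpNorm_lim_le_liminf_eLpNorm (p := 6) (μ := (volume : Measure E3))
    (f := fun n x => η (c n • x) • u x)
    (fun n => ((hη.continuous.comp (continuous_const_smul (c n))).smul
      hu.continuous).aestronglyMeasurable) u (ae_of_all _ hlim)
  have ht : Filter.Tendsto (fun n => (K : ENNReal) * (eLpNorm (fderiv ℝ u) 2
      + ENNReal.ofReal (|c n| * M) * eLpNorm u 2)) Filter.atTop
      (nhds (K * (eLpNorm (fderiv ℝ u) 2 + 0))) := by
    refine ENNReal.Tendsto.const_mul (Filter.Tendsto.add tendsto_const_nhds ?_)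
      (Or.inr ENNReal.coe_ne_top)
    have h1 : Filter.Tendsto (fun n => ENNReal.ofReal (|c n| * M)) Filter.atTop (nhds 0) := by
      rw [← ENNReal.ofReal_zero]
      refine ENNReal.tendsto_ofReal ?_
      simpa using hc0.abs.mul_const M
    simpa using ENNReal.Tendsto.mul_const h1 (Or.inr h2.2.ne)
  have hm := Filter.liminf_le_liminf (f := Filter.atTop) (Filter.Eventually.of_forall hb)
  rw [ht.liminf_eq, add_zero] at hm
  exact hl.trans hm

lemma opNorm_sq_le_sum (L : E3 →L[ℝ] ℂ) :
    ‖L‖ ^ 2 ≤ ∑ k, ‖L (EuclideanSpace.single k 1)‖ ^ 2 := by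
  set S := ∑ k, ‖L (EuclideanSpace.single k 1)‖ ^ 2 with hS
  have hS0 : 0 ≤ S := Finset.sum_nonneg fun _ _ => by positivity
  refine (Real.le_sqrt (norm_nonneg _) hS0).1
    (L.opNorm_le_bound (Real.sqrt_nonneg _) fun x => ?_)
  have hx : x = ∑ k, x k • EuclideanSpace.single k (1:ℝ) := by
    ext i; simp [Pi.single_apply]
  have h1 : ‖L x‖ ≤ ∑ k, ‖L (EuclideanSpace.single k 1)‖ * |x k| := by
    conv_lhs => rw [hx]
    rw [map_sum]
    refine (norm_sum_le _ _).trans (Finset.sum_le_sum fun k _ => ?_)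
    rw [map_smul, norm_smul, mul_comm, Real.norm_eq_abs]
  refine h1.trans ?_
  have h2 := Real.sum_mul_le_sqrt_mul_sqrt Finset.univ
    (fun k => ‖L (EuclideanSpace.single k 1)‖) (fun k => |x k|)
  refine h2.trans_eq ?_
  rw [EuclideanSpace.norm_eq]
  simp [hS]

/-- The phase of the pseudoconformal transformation. -/
def confPhase (t : ℝ) (x : E3) : ℂ := Complex.exp (-(((‖x‖ ^ 2 / (4 * t) : ℝ) : ℂ) * Complex.I))

lemma norm_confPhase (t : ℝ) (x : E3) : ‖confPhase t x‖ = 1 := by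
  rw [confPhase, ← neg_mul, ← Complex.ofReal_neg, Complex.norm_exp_ofReal_mul_I]

lemma contDiff_confPhase (t : ℝ) : ContDiff ℝ 1 (confPhase t) := by
  have : ContDiff ℝ 1 (fun x : E3 => ‖x‖ ^ 2 / (4 * t)) := (contDiff_norm_sq ℝ).div_const _
  exact ((Complex.ofRealCLM.contDiff.comp this).mul contDiff_const).neg.cexp

lemma hasFDerivAt_confPhase (t : ℝ) (x : E3) (k : Fin 3) :
    fderiv ℝ (confPhase t) x (EuclideanSpace.single k 1)
      = confPhase t x * -(((x k / (2 * t) : ℝ) : ℂ) * Complex.I) := by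
  have h1 : HasFDerivAt (fun x : E3 => ‖x‖ ^ 2) (2 • innerSL ℝ x) x :=
    (hasStrictFDerivAt_norm_sq x).hasFDerivAt
  have h2 := ((Complex.ofRealCLM.hasFDerivAt.comp x (h1.mul_const ((4 * t)⁻¹))).mul_const
    Complex.I).neg.cexp
  have h3 : HasFDerivAt (confPhase t) _ x := h2
  rw [h3.fderiv]
  simp [confPhase, EuclideanSpace.inner_single_right, div_eq_mul_inv]
  ring

lemma norm_fderiv_confPhase_mul {F : ℝ × E3 → ℂ} (hF : RapidDecay F) {t : ℝ} (ht : 0 < t) (x : E3)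
    (k : Fin 3) :
    ‖fderiv ℝ (fun y => confPhase t y * F (t, y)) x (EuclideanSpace.single k 1)‖
      = ‖galilei k F (t, x)‖ / (2 * t) := by
  have h1 := ((contDiff_confPhase t).differentiable one_ne_zero x).hasFDerivAt
  have h2 := hasFDerivAt_slice hF.differentiable t x
  have h3 := (h1.mul h2).fderiv
  have e : fderiv ℝ (fun y => confPhase t y * F (t, y)) x (EuclideanSpace.single k 1)
      = confPhase t x * (-Complex.I) * ((galilei k F (t, x)) / ((2 * t : ℝ) : ℂ)) := by
    have h4 : fderiv ℝ (fun y => confPhase t y * F (t, y)) x = _ := h3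
    have h5 : fderiv ℝ F (t, x) (0, EuclideanSpace.single k 1) = dirD (spaceDir k) F (t, x) := rfl
    rw [h4]
    simp only [add_apply, smul_apply,
      ContinuousLinearMap.comp_apply, ContinuousLinearMap.inr_apply, hasFDerivAt_confPhase,
      smul_eq_mul, h5, galilei]
    have : (t : ℂ) ≠ 0 := by exact_mod_cast ht.ne'
    push_cast
    field_simp
    linear_combination (2 * confPhase t x * t * dirD (spaceDir k) F (t, x)) * Complex.I_sq
  rw [e, norm_mul, norm_mul, norm_confPhase, norm_neg, Complex.norm_I, norm_div,
    Complex.norm_real, Real.norm_of_nonneg (by positivity)]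
  ring

lemma RapidDecay.integrable_norm_pow {F : ℝ × E3 → ℂ} (hF : RapidDecay F) (t : ℝ) (n : ℕ) :
    Integrable (fun x => ‖F (t, x)‖ ^ (n + 1)) := by
  obtain ⟨C, h0, hC⟩ := hF.bound |t|
  have : ∀ x, ‖F (t, x)‖ ≤ C := fun x =>
    (hC t x le_rfl).trans (mul_le_of_le_one_right h0 (bracket_le_one x))
  simp only [pow_succ]
  refine (hF.integrable t).norm.bdd_mul (c := C ^ n)
    ((hF.continuous_slice t).norm.pow n).aestronglyMeasurable (ae_of_all _ fun x => ?_)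
  rw [norm_pow, norm_norm]
  exact pow_le_pow_left₀ (norm_nonneg _) (this x) n

lemma RapidDecay.eLpNorm_pow {F : ℝ × E3 → ℂ} (hF : RapidDecay F) (t : ℝ) (n : ℕ) :
    eLpNorm (fun x => F (t, x)) ((n + 1 : ℕ) : ENNReal) ^ (n + 1)
      = ENNReal.ofReal (∫ x, ‖F (t, x)‖ ^ (n + 1)) := by
  rw [ofReal_integral_eq_lintegral_ofReal (hF.integrable_norm_pow t n)
    (ae_of_all _ fun x => by positivity),
    eLpNorm_eq_lintegral_rpow_enorm_toReal (by simp) (by simp)]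
  rw [← ENNReal.rpow_natCast, ← ENNReal.rpow_mul]
  simp only [ENNReal.toReal_natCast]
  rw [one_div, inv_mul_cancel₀ (by positivity), ENNReal.rpow_one]
  congr 1; funext x
  rw [ENNReal.rpow_natCast, ENNReal.ofReal_pow (norm_nonneg _), ofReal_norm]

lemma RapidDecay.memLp_two {F : ℝ × E3 → ℂ} (hF : RapidDecay F) (t : ℝ) :
    MemLp (fun x => F (t, x)) 2 :=
  (memLp_two_iff_integrable_sq_norm (hF.continuous_slice t).aestronglyMeasurable).2
    (hF.integrable_norm_pow t 1)

lemma eLpNorm_fderiv_confPhase_mul_sq_le {F : ℝ × E3 → ℂ} (hF : RapidDecay F) {t : ℝ}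
    (ht : 0 < t) :
    eLpNorm (fderiv ℝ (fun y => confPhase t y * F (t, y))) 2 ^ 2
      ≤ ENNReal.ofReal (galileiEnergy F t / (4 * t ^ 2)) := by
  have hfd : ∀ x, ‖fderiv ℝ (fun y => confPhase t y * F (t, y)) x‖ ^ 2
      ≤ ∑ k, ‖galilei k F (t, x)‖ ^ 2 / (4 * t ^ 2) := fun x => by
    refine (opNorm_sq_le_sum _).trans_eq (Finset.sum_congr rfl fun k _ => ?_)
    rw [norm_fderiv_confPhase_mul hF ht]
    ring
  have hgi : ∀ k, Integrable (fun x => ‖galilei k F (t, x)‖ ^ 2 / (4 * t ^ 2)) := fun k =>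
    ((hF.galilei k).integrable_norm_pow t 1).div_const _
  have hI : ∫ x, ∑ k, ‖galilei k F (t, x)‖ ^ 2 / (4 * t ^ 2) = galileiEnergy F t / (4 * t ^ 2) := by
    rw [integral_finsetSum _ fun k _ => hgi k]
    simp only [integral_div, galileiEnergy, Finset.sum_div]
  rw [← hI, ofReal_integral_eq_lintegral_ofReal (integrable_finsetSum _ fun k _ => hgi k)
    (ae_of_all _ fun x => Finset.sum_nonneg fun k _ => by positivity),
    eLpNorm_eq_lintegral_rpow_enorm_toReal (by simp) (by simp), ← ENNReal.rpow_natCast,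
    ← ENNReal.rpow_mul]
  norm_num
  refine lintegral_mono fun x => ?_
  simp only
  rw [← ofReal_norm, ← ENNReal.ofReal_pow (norm_nonneg _)]
  exact ENNReal.ofReal_le_ofReal (hfd x)

lemma exists_eLpNorm_six_le : ∃ K : NNReal, ∀ {F : ℝ × E3 → ℂ}, RapidDecay F →
    ∀ t : ℝ, 0 < t → eLpNorm (fun x => F (t, x)) 6
      ≤ K * eLpNorm (fderiv ℝ (fun y => confPhase t y * F (t, y))) 2 := by
  obtain ⟨C, hC⟩ := exists_eLpNorm_six_le_fderiv
  refine ⟨C, fun {F} hF t ht => ?_⟩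
  have hn : ∀ x, ‖confPhase t x * F (t, x)‖ = ‖F (t, x)‖ := fun x => by simp [norm_confPhase]
  have hFs : ContDiff ℝ 1 (fun x => F (t, x)) :=
    (hF.smooth.of_le (by exact_mod_cast le_top)).comp (contDiff_prodMk_right t)
  have hs : ContDiff ℝ 1 (fun y => confPhase t y * F (t, y)) := (contDiff_confPhase t).mul hFs
  have h2 : MemLp (fun y => confPhase t y * F (t, y)) 2 :=
    (memLp_congr_norm hs.continuous.aestronglyMeasurable
      (hF.continuous_slice t).aestronglyMeasurable (ae_of_all _ hn)).2 (hF.memLp_two t)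
  have key := hC _ hs h2
  rwa [eLpNorm_congr_norm_ae (ae_of_all _ hn)] at key

/-- Klainerman–Sobolev type estimate. -/
lemma exists_integral_norm_pow_six_le : ∃ K : ℝ, 0 ≤ K ∧ ∀ {F : ℝ × E3 → ℂ}, RapidDecay F →
    ∀ t : ℝ, 0 < t → ∫ x, ‖F (t, x)‖ ^ 6 ≤ K * (galileiEnergy F t / t ^ 2) ^ 3 := by
  obtain ⟨C, hC⟩ := exists_eLpNorm_six_le
  refine ⟨(C : ℝ) ^ 6 * (1 / 4) ^ 3, by positivity, fun {F} hF t ht => ?_⟩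
  have key := hC hF t ht
  have hD := eLpNorm_fderiv_confPhase_mul_sq_le hF ht
  have h6 := hF.eLpNorm_pow t 5
  norm_num at h6
  have hge : 0 ≤ galileiEnergy F t / (4 * t ^ 2) :=
    div_nonneg (galileiEnergy_nonneg t) (by positivity)
  have hK : (C : ℝ) ^ 6 * (1 / 4) ^ 3 * (galileiEnergy F t / t ^ 2) ^ 3
      = (C : ℝ) ^ 6 * (galileiEnergy F t / (4 * t ^ 2)) ^ 3 := by ring
  rw [hK]
  generalize galileiEnergy F t / (4 * t ^ 2) = e at hD hge ⊢
  generalize eLpNorm (fderiv ℝ (fun y => confPhase t y * F (t, y))) 2 = n at key hD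
  rw [← ENNReal.ofReal_le_ofReal_iff (by positivity), ← h6, ENNReal.ofReal_mul (by positivity),
    ENNReal.ofReal_pow hge, ← NNReal.coe_pow, ENNReal.ofReal_coe_nnreal, ENNReal.coe_pow]
  refine (pow_le_pow_left' key 6).trans ?_
  rw [mul_pow, show n ^ 6 = (n ^ 2) ^ 3 by rw [← pow_mul]]
  exact mul_le_mul_right (pow_le_pow_left' hD 3) _

/-- Interpolation of the fourth power integral between the second and the sixth. -/
lemma RapidDecay.integral_pow_four_sq_le {F : ℝ × E3 → ℂ} (hF : RapidDecay F) (t : ℝ) :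
    (∫ x, ‖F (t, x)‖ ^ 4) ^ 2 ≤ (∫ x, ‖F (t, x)‖ ^ 2) * ∫ x, ‖F (t, x)‖ ^ 6 := by
  have i2 := hF.integrable_norm_pow t 1
  have i4 := hF.integrable_norm_pow t 3
  have i6 := hF.integrable_norm_pow t 5
  norm_num at i2 i4 i6
  have h : ∀ s : ℝ, 0 ≤ (∫ x, ‖F (t, x)‖ ^ 6) * (s * s) + (-2 * ∫ x, ‖F (t, x)‖ ^ 4) * s
      + ∫ x, ‖F (t, x)‖ ^ 2 := fun s => by
    have : ∀ x, 0 ≤ (s * s) * ‖F (t, x)‖ ^ 6 + (-2 * s) * ‖F (t, x)‖ ^ 4 + ‖F (t, x)‖ ^ 2 :=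
      fun x => by nlinarith [sq_nonneg (s * ‖F (t, x)‖ ^ 3 - ‖F (t, x)‖)]
    have h0 : 0 ≤ ∫ x, ((s * s) * ‖F (t, x)‖ ^ 6 + (-2 * s) * ‖F (t, x)‖ ^ 4 + ‖F (t, x)‖ ^ 2) :=
      integral_nonneg fun x => this x
    have i64 : Integrable (fun x => (s * s) * ‖F (t, x)‖ ^ 6 + (-2 * s) * ‖F (t, x)‖ ^ 4) :=
      (i6.const_mul _).add (i4.const_mul _)
    rw [integral_add i64 i2, integral_add (i6.const_mul _) (i4.const_mul _), integral_const_mul,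
      integral_const_mul] at h0
    linarith
  have := discrim_le_zero h
  rw [discrim] at this
  nlinarith

/-- A Gronwall bootstrap for the pseudoconformal energy. -/
lemma exists_bound_of_growth {E Q : ℝ → ℝ} {K : ℝ} (hK : 0 ≤ K)
    (hE : ∀ t, 1 ≤ t → ∃ d, HasDerivAt E d t ∧ d ≤ 2 * t * Q t)
    (hQ0 : ∀ t, 0 ≤ Q t) (hQE : ∀ t, 2 * t ^ 2 * Q t ≤ E t)
    (hQ : ∀ t, 1 ≤ t → Q t ^ 2 ≤ K * (E t / t ^ 2) ^ 3) : ∃ B, 0 ≤ B ∧ ∀ t, 1 ≤ t → E t ≤ B := by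
  have hE0 : ∀ t, 0 ≤ E t := fun t =>
    (mul_nonneg (by positivity) (hQ0 t)).trans (hQE t)
  choose! d hd hdle using hE
  have anti : ∀ {w w' : ℝ → ℝ}, (∀ t, 1 ≤ t → HasDerivAt w (w' t) t) →
      (∀ t, 1 ≤ t → d t * w t + E t * w' t ≤ 0) → ∀ t, 1 ≤ t → E t * w t ≤ E 1 * w 1 := by
    intro w w' hw hneg t ht
    have hh : ∀ s, 1 ≤ s → HasDerivAt (fun s => E s * w s) (d s * w s + E s * w' s) s :=
      fun s hs => (hd s hs).fun_mul (hw s hs)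
    refine antitoneOn_of_deriv_nonpos (convex_Ici (1:ℝ))
      (fun s hs => (hh s hs).continuousAt.continuousWithinAt)
      (fun s hs => (hh s (interior_subset hs)).differentiableAt.differentiableWithinAt)
      (fun s hs => ?_) (Set.mem_Ici.2 le_rfl) (Set.mem_Ici.2 ht) ht
    rw [(hh s (interior_subset hs)).deriv]
    exact hneg s (interior_subset hs)
  have h1 : ∀ t, 1 ≤ t → E t ≤ E 1 * t := fun t ht => by
    have := anti (w := fun t => t⁻¹) (w' := fun t => -(t ^ 2)⁻¹)
      (fun s hs => hasDerivAt_inv (by linarith)) (fun s hs => ?_) t ht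
    · have ht0 : 0 < t := by linarith
      rw [← div_eq_mul_inv, div_le_iff₀ ht0] at this
      simpa using this
    · have hs0 : 0 < s := by linarith
      have := hdle s hs
      have h2 := hQE s
      rw [show d s * s⁻¹ + E s * -(s ^ 2)⁻¹ = (d s * s - E s) / s ^ 2 by
        field_simp; ring]
      refine div_nonpos_of_nonpos_of_nonneg ?_ (by positivity)
      nlinarith
  set A := Real.sqrt (K * E 1) with hA
  have hA0 : 0 ≤ A := Real.sqrt_nonneg _
  have h2 : ∀ t, 1 ≤ t → Q t ≤ A * E t * t ^ (-(5/2) : ℝ) := fun t ht => by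
    have ht0 : 0 < t := by linarith
    refine le_of_sq_le_sq ?_ (mul_nonneg (mul_nonneg hA0 (hE0 t)) (by positivity))
    have e : (t ^ (-(5/2) : ℝ)) ^ 2 = (t ^ 5)⁻¹ := by
      rw [← Real.rpow_natCast, ← Real.rpow_mul ht0.le]
      norm_num [Real.rpow_neg ht0.le]
    rw [mul_pow, mul_pow, e, hA, Real.sq_sqrt (mul_nonneg hK (hE0 1))]
    refine (hQ t ht).trans ?_
    calc K * (E t / t ^ 2) ^ 3 = K * E t ^ 2 * (t ^ 6)⁻¹ * E t := by field_simp
      _ ≤ K * E t ^ 2 * (t ^ 6)⁻¹ * (E 1 * t) :=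
          mul_le_mul_of_nonneg_left (h1 t ht) (by positivity)
      _ = _ := by field_simp
  refine ⟨E 1 * Real.exp (4 * A), mul_nonneg (hE0 1) (Real.exp_pos _).le, fun t ht => ?_⟩
  have h3 := anti (w := fun t => Real.exp (4 * A * t ^ (-(1/2) : ℝ)))
    (w' := fun t => Real.exp (4 * A * t ^ (-(1/2) : ℝ)) * (-2 * A * t ^ (-(3/2) : ℝ)))
    (fun s hs => ?_) (fun s hs => ?_) t ht
  · simp only [Real.one_rpow, mul_one] at h3
    refine le_trans ?_ h3
    exact le_mul_of_one_le_right (hE0 t) (Real.one_le_exp (by positivity))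
  · have hs0 : 0 < s := by linarith
    have := ((Real.hasDerivAt_rpow_const (p := -(1/2)) (Or.inl hs0.ne')).const_mul (4 * A)).exp
    refine this.congr_deriv ?_
    rw [show (-(1/2) - 1 : ℝ) = -(3/2) by norm_num]
    ring
  · have hs0 : 0 < s := by linarith
    have e : s ^ (-(3/2) : ℝ) = s * s ^ (-(5/2) : ℝ) := by
      rw [← Real.rpow_one_add' hs0.le (by norm_num)]; norm_num
    have h4 : d s ≤ 2 * A * s ^ (-(3/2) : ℝ) * E s := by
      rw [e]
      calc d s ≤ 2 * s * Q s := hdle s hs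
        _ ≤ 2 * s * (A * E s * s ^ (-(5/2) : ℝ)) :=
            mul_le_mul_of_nonneg_left (h2 s hs) (by positivity)
        _ = _ := by ring
    nlinarith [Real.exp_pos (4 * A * s ^ (-(1/2) : ℝ))]

lemma HartreeFlow.interaction_sq_le {χ : ℝ → ℝ} {F G : ℝ × E3 → ℂ} (h : HartreeFlow χ F G)
    (t : ℝ) : interaction χ F t ^ 2
      ≤ (∫ z, coulombPot χ z) ^ 2 * (∫ x, ‖F (0, x)‖ ^ 2) * ∫ x, ‖F (t, x)‖ ^ 6 := by
  obtain ⟨C, hC⟩ := h.rapid.normSq_bracketDom |t|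
  have h1 := pairForm_le (integrable_coulombPot h.cutoff) (coulombPot_nonneg h.cutoff)
    (hC t le_rfl)
  have h2 := h.rapid.integral_pow_four_sq_le t
  simp only [← pow_mul] at h1
  norm_num at h1
  rw [h.mass_conserved t 0] at h2
  calc interaction χ F t ^ 2 ≤ ((∫ z, coulombPot χ z) * ∫ x, ‖F (t, x)‖ ^ 4) ^ 2 :=
        pow_le_pow_left₀ (h.interaction_nonneg t) h1 2
    _ = (∫ z, coulombPot χ z) ^ 2 * (∫ x, ‖F (t, x)‖ ^ 4) ^ 2 := by ring
    _ ≤ (∫ z, coulombPot χ z) ^ 2 * ((∫ x, ‖F (0, x)‖ ^ 2) * ∫ x, ‖F (t, x)‖ ^ 6) := by gcongr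
    _ = _ := by ring

/-- Decay of the sixth power integral of a Hartree flow. -/
lemma HartreeFlow.exists_integral_pow_six_le {χ : ℝ → ℝ} {F G : ℝ × E3 → ℂ}
    (h : HartreeFlow χ F G) :
    ∃ B, 0 ≤ B ∧ ∀ t, 1 ≤ t → ∫ x, ‖F (t, x)‖ ^ 6 ≤ B / t ^ 6 := by
  obtain ⟨K, hK0, hK⟩ := exists_integral_norm_pow_six_le
  have hJE : ∀ t, galileiEnergy F t ≤ confEnergy χ F t := fun t =>
    le_add_of_nonneg_right (mul_nonneg (by positivity) (h.interaction_nonneg t))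
  have h6 : ∀ t, 1 ≤ t → ∫ x, ‖F (t, x)‖ ^ 6 ≤ K * (confEnergy χ F t / t ^ 2) ^ 3 :=
      fun t ht => by
    refine (hK h.rapid t (by linarith)).trans (mul_le_mul_of_nonneg_left ?_ hK0)
    exact pow_le_pow_left₀ (div_nonneg (galileiEnergy_nonneg t) (by positivity))
      (div_le_div_of_nonneg_right (hJE t) (by positivity)) 3
  have hc : 0 ≤ (∫ z, coulombPot χ z) ^ 2 * (∫ x, ‖F (0, x)‖ ^ 2) :=
    mul_nonneg (by positivity) (integral_nonneg fun _ => by positivity)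
  obtain ⟨B, hB0, hB⟩ := exists_bound_of_growth (E := confEnergy χ F) (Q := interaction χ F)
    (K := (∫ z, coulombPot χ z) ^ 2 * (∫ x, ‖F (0, x)‖ ^ 2) * K) (mul_nonneg hc hK0)
    (fun t ht => h.hasDerivAt_confEnergy t (by linarith)) h.interaction_nonneg
    (fun t => le_add_of_nonneg_left (galileiEnergy_nonneg t))
    (fun t ht => (h.interaction_sq_le t).trans
      ((mul_le_mul_of_nonneg_left (h6 t ht) hc).trans_eq (by ring)))
  refine ⟨K * B ^ 3, by positivity, fun t ht => (h6 t ht).trans ?_⟩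
  have hE0 : 0 ≤ confEnergy χ F t := (galileiEnergy_nonneg t).trans (hJE t)
  calc K * (confEnergy χ F t / t ^ 2) ^ 3 ≤ K * (B / t ^ 2) ^ 3 := by
        have := hB t ht
        gcongr
    _ = K * B ^ 3 / t ^ 6 := by ring

lemma lintegral_Ici_lt_top {f : ℝ → ENNReal} {C a : ℝ} (ha : a < -1)
    (hf : ∀ t, 1 ≤ t → f t ≤ ENNReal.ofReal (C * t ^ a)) :
    ∫⁻ t in Set.Ici (1:ℝ), f t < ⊤ := by
  have hi : IntegrableOn (fun t : ℝ => C * t ^ a) (Set.Ici 1) := by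
    rw [integrableOn_Ici_iff_integrableOn_Ioi]
    exact (integrableOn_Ioi_rpow_of_lt ha one_pos).const_mul C
  calc ∫⁻ t in Set.Ici (1:ℝ), f t ≤ ∫⁻ t in Set.Ici (1:ℝ), ENNReal.ofReal (C * t ^ a) :=
        setLIntegral_mono_ae' measurableSet_Ici (ae_of_all _ hf)
    _ < ⊤ := hi.lintegral_lt_top

lemma ENNReal.sq_le_of_pow_le {a : ENNReal} {n : ℕ} (hn : n ≠ 0) {b : ℝ} (hb : 0 ≤ b)
    (h : a ^ n ≤ ENNReal.ofReal b) : a ^ 2 ≤ ENNReal.ofReal (b ^ ((2 : ℝ) / n)) := by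
  have hn' : (0:ℝ) < n := by positivity
  rw [← ENNReal.ofReal_rpow_of_nonneg hb (by positivity)]
  calc a ^ 2 = (a ^ n) ^ ((2 : ℝ) / n) := by
        rw [← ENNReal.rpow_natCast, ← ENNReal.rpow_natCast, ← ENNReal.rpow_mul]
        congr 1; field_simp; norm_num
    _ ≤ _ := ENNReal.rpow_le_rpow h (by positivity)

lemma lapC_slice {F : ℝ × E3 → ℂ} (hF : RapidDecay F) (t : ℝ) (x : E3) :
    lapC (fun y => F (t, y)) x = spaceLap F (t, x) := by
  simp only [lapC, spaceLap, fderiv_slice hF.differentiable,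
    fderiv_slice (hF.directional _).differentiable]

lemma IsHartreeSolution.exists_hartreeFlow {v : E3 → ℝ} {χ : ℝ → ℝ} (hχ : IsCutoff χ)
    (hv : ∀ x : E3, x ≠ 0 → v x = χ ‖x‖ / ‖x‖) {φ : ℝ → E3 → ℂ} (hφ : IsHartreeSolution v φ) :
    ∃ G, HartreeFlow χ (fun p => φ p.1 p.2) G := by
  have hF : RapidDecay (fun p : ℝ × E3 => φ p.1 p.2) := ⟨hφ.smooth, hφ.decay⟩
  refine ⟨fun p => Complex.I * dirD timeDir (fun p => φ p.1 p.2) p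
    + spaceLap (fun p => φ p.1 p.2) p, hχ, hF,
    ((hF.directional _).const_mul _).add hF.spaceLap, fun p => ?_, fun t x => ?_⟩
  · linear_combination (dirD timeDir (fun p => φ p.1 p.2) p) * Complex.I_sq
  · have h1 := hφ.eqn t x
    have h2 := (hasDerivAt_time hF.differentiable t x).deriv
    have h3 := lapC_slice hF t x
    simp only at h2 h3
    have h4 : hartreeW v (φ t) x = ∫ z, coulombPot χ z * ‖φ t (x - z)‖ ^ 2 := by
      rw [hartreeW, convolution]
      refine integral_congr_ae ?_
      filter_upwards [compl_mem_ae_iff.2 (measure_singleton (0 : E3))] with z hz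
      simp [hv z hz, coulombPot]
    rw [h2, show lapC (φ t) x = _ from h3, h4] at h1
    linear_combination h1

end DecayOfHartreeFlows

/-- Square integrability in time of the decay norms:
`∫_1^∞ ‖φ(t)‖²_{L⁶} dt < ∞` and `∫_1^∞ ‖φ(t)‖²_{L⁴} dt < ∞`. -/
theorem decay_norms_square_integrable (v : E3 → ℝ) (χ : ℝ → ℝ) (hχ : IsCutoff χ)
    (hv : ∀ x : E3, x ≠ 0 → v x = χ ‖x‖ / ‖x‖)
    (φ : ℝ → E3 → ℂ) (hφ : IsHartreeSolution v φ) :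
    (∫⁻ t in Set.Ici (1:ℝ), eLpNorm (φ t) 6 volume ^ 2) < ⊤ ∧
    (∫⁻ t in Set.Ici (1:ℝ), eLpNorm (φ t) 4 volume ^ 2) < ⊤ := by
  obtain ⟨G, h⟩ := hφ.exists_hartreeFlow hχ hv
  obtain ⟨B, hB0, hB⟩ := h.exists_integral_pow_six_le
  have hM : 0 ≤ ∫ x, ‖φ 0 x‖ ^ 2 := integral_nonneg fun _ => by positivity
  constructor
  · refine lintegral_Ici_lt_top (C := B ^ ((2 : ℝ) / (6 : ℕ))) (a := -2) (by norm_num)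
      fun t ht => ?_
    have ht0 : 0 < t := by linarith
    have h6 := h.rapid.eLpNorm_pow t 5
    norm_num at h6
    refine (ENNReal.sq_le_of_pow_le (by norm_num) (b := B / t ^ 6) (by positivity)
      (h6.trans_le (ENNReal.ofReal_le_ofReal (hB t ht)))).trans_eq ?_
    rw [div_eq_mul_inv, Real.mul_rpow hB0 (by positivity), Real.inv_rpow (by positivity),
      ← Real.rpow_natCast_mul ht0.le, ← Real.rpow_neg ht0.le]
    norm_num
  · refine lintegral_Ici_lt_top (C := ((∫ x, ‖φ 0 x‖ ^ 2) * B) ^ ((2 : ℝ) / (8 : ℕ)))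
      (a := -(3 / 2)) (by norm_num) fun t ht => ?_
    have ht0 : 0 < t := by linarith
    have h4 := h.rapid.eLpNorm_pow t 3
    norm_num at h4
    have h8 : eLpNorm (φ t) 4 volume ^ 8
        ≤ ENNReal.ofReal ((∫ x, ‖φ 0 x‖ ^ 2) * B / t ^ 6) := by
      rw [show 8 = 4 * 2 from rfl, pow_mul, h4,
        ← ENNReal.ofReal_pow (integral_nonneg fun _ => by positivity)]
      refine ENNReal.ofReal_le_ofReal ((h.rapid.integral_pow_four_sq_le t).trans ?_)
      rw [h.mass_conserved t 0, mul_div_assoc]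
      exact mul_le_mul_of_nonneg_left (hB t ht) hM
    refine (ENNReal.sq_le_of_pow_le (by norm_num) (by positivity) h8).trans_eq ?_
    rw [div_eq_mul_inv, Real.mul_rpow (by positivity) (by positivity),
      Real.inv_rpow (by positivity), ← Real.rpow_natCast_mul ht0.le, ← Real.rpow_neg ht0.le]
    norm_num
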